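/- arXiv:2002.12234 — 2 statements merged into one kernel-verified Lean document; each statement's English description precedes it below -/
import Mathlib

section
/- Let k ≥ 4 be even, d ≥ k/2, and n sufficiently large. Suppose H is an n-vertex k-graph with a partition V(H) = A ∪ B, |A|, |B| ≥ 0.4n, such that every d-set of vertices lies in strictly more edges of H than its degree in B_{n,k}(A,B) (the k-graph of all k-sets odd with respect to A). Then among the edges of H that are even with respect to A there exist two edges e₁, e₂ with |e₁ ∩ e₂| ∈ {0, k/2}. -/
open Finset in
/-- Frankl–Katona: fewer than `|Y|` sets on `Y`; some nonempty `P` lies in exactly `|P| - 1` sets. -/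
theorem frankl_katona {ι κ : Type} [DecidableEq ι] [DecidableEq κ] (S : κ → Finset ι) :
    ∀ (n : ℕ) (Y : Finset ι) (X : Finset κ), Y.card = n → X.card < Y.card →
      ∃ P ⊆ Y, P.Nonempty ∧ (X.filter (fun x => P ⊆ S x)).card + 1 = P.card := by
  intro n
  induction n using Nat.strong_induction_on with
  | _ n ih =>
  intro Y X hY hXY
  by_contra hno
  push Not at hno
  have hd : ∀ y ∈ Y, 0 < (X.filter (fun x => y ∈ S x)).card := by
    intro y hy
    have := hno {y} (by simpa using hy) (by simp)
    simp only [Finset.singleton_subset_iff, Finset.card_singleton] at this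
    omega
  have hds : ∀ x ∈ X, ∀ y ∈ Y, y ∈ S x →
      (Y.filter (fun y => y ∈ S x)).card ≤ (X.filter (fun x => y ∈ S x)).card := by
    intro x hx y hy hyx
    by_contra hlt
    push Not at hlt
    have hyY : y ∈ Y.filter (fun y => y ∈ S x) := by simp [hy, hyx]
    have hxX : x ∈ X.filter (fun x => y ∈ S x) := by simp [hx, hyx]
    have c1 := Finset.card_erase_add_one hyY
    have c2 := Finset.card_erase_add_one hxX
    have c3 : (Y.filter (fun y => y ∈ S x)).card ≤ Y.card := Finset.card_filter_le _ _
    obtain ⟨P, hPY, hPne, hP⟩ := ih ((Y.filter (fun y => y ∈ S x)).erase y).card (by omega)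
      ((Y.filter (fun y => y ∈ S x)).erase y) ((X.filter (fun x => y ∈ S x)).erase x) rfl (by omega)
    have hyP : y ∉ P := fun h => by simpa using hPY h
    have hPx : P ⊆ S x := fun z hz => by
      have := hPY hz
      simp at this
      exact this.2.2
    have hPY' : P ⊆ Y := fun z hz => by
      have := hPY hz
      simp at this
      exact this.2.1
    apply hno (insert y P) (Finset.insert_subset hy hPY') (by simp)
    have heq : X.filter (fun x' => insert y P ⊆ S x') =
        insert x (((X.filter (fun x => y ∈ S x)).erase x).filter (fun x' => P ⊆ S x')) := by
      ext x'
      simp only [Finset.mem_filter, Finset.mem_insert, Finset.mem_erase, Finset.insert_subset_iff]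
      by_cases h : x' = x
      · subst h; simp [hx, hyx, hPx]
      · simp [h]; tauto
    rw [heq, Finset.card_insert_of_notMem (by simp), Finset.card_insert_of_notMem hyP, hP]
  have key : (Y.card : ℚ) ≤ X.card := by
    calc (Y.card : ℚ) = ∑ y ∈ Y, ∑ x ∈ X, if y ∈ S x then
            (1 : ℚ) / (X.filter (fun x => y ∈ S x)).card else 0 := by
          rw [Finset.card_eq_sum_ones]
          push_cast
          apply Finset.sum_congr rfl
          intro y hy
          rw [← Finset.sum_filter, Finset.sum_const, nsmul_eq_mul]
          have := hd y hy
          field_simp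
      _ = ∑ x ∈ X, ∑ y ∈ Y, if y ∈ S x then
            (1 : ℚ) / (X.filter (fun x => y ∈ S x)).card else 0 := Finset.sum_comm
      _ ≤ ∑ x ∈ X, (1 : ℚ) := by
          apply Finset.sum_le_sum
          intro x hx
          rw [← Finset.sum_filter]
          by_cases h0 : (Y.filter (fun y => y ∈ S x)).card = 0
          · rw [Finset.card_eq_zero] at h0
            rw [h0]; simp
          calc ∑ y ∈ Y.filter (fun y => y ∈ S x), (1 : ℚ) / (X.filter (fun x => y ∈ S x)).card
              ≤ ∑ y ∈ Y.filter (fun y => y ∈ S x),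
                  (1 : ℚ) / (Y.filter (fun y => y ∈ S x)).card := by
                apply Finset.sum_le_sum
                intro y hy
                rw [Finset.mem_filter] at hy
                apply one_div_le_one_div_of_le
                · exact_mod_cast Nat.pos_of_ne_zero h0
                · exact_mod_cast hds x hx y hy.1 hy.2
            _ = 1 := by
                rw [Finset.sum_const, nsmul_eq_mul]
                field_simp
            _ ≤ 1 := le_refl _
      _ = X.card := by simp
  have : Y.card ≤ X.card := by exact_mod_cast key
  omega

theorem end_hom (C : Type) [Fintype C] [DecidableEq C] [Nonempty C] (s : ℕ) :
    ∃ M : ℕ, ∀ (f : ℕ → ℕ → C) (X : Finset ℕ), M ≤ X.card →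
      ∃ Y ⊆ X, Y.card = s ∧ ∃ c : ℕ → C, ∀ p ∈ Y, ∀ q ∈ Y, p < q → f p q = c p := by
  induction s with
  | zero => exact ⟨0, fun f X _ => ⟨∅, by simp, by simp, fun _ => Classical.arbitrary C, by simp⟩⟩
  | succ s ih =>
    obtain ⟨M, hM⟩ := ih
    refine ⟨Fintype.card C * M + 1, fun f X hX => ?_⟩
    have hne : X.Nonempty := by rw [← Finset.card_pos]; omega
    set p := X.min' hne with hp
    have hpX : p ∈ X := X.min'_mem hne
    have c1 := Finset.card_erase_add_one hpX
    obtain ⟨c0, _, hc0⟩ := Finset.exists_le_card_fiber_of_mul_le_card_of_maps_to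
      (s := X.erase p) (t := (Finset.univ : Finset C)) (f := fun q => f p q) (n := M)
      (by simp) Finset.univ_nonempty (by rw [Finset.card_univ]; omega)
    obtain ⟨Y, hYX, hYc, c, hc⟩ := hM f _ hc0
    have hYp : ∀ q ∈ Y, q ≠ p ∧ q ∈ X ∧ f p q = c0 := by
      intro q hq
      have := hYX hq
      simp only [Finset.mem_filter, Finset.mem_erase] at this
      tauto
    have hpY : p ∉ Y := fun h => (hYp p h).1 rfl
    have hlt : ∀ q ∈ Y, p < q := fun q hq =>
      lt_of_le_of_ne (X.min'_le q (hYp q hq).2.1) (hYp q hq).1.symm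
    refine ⟨insert p Y, ?_, by rw [Finset.card_insert_of_notMem hpY, hYc],
      fun q => if q = p then c0 else c q, ?_⟩
    · exact Finset.insert_subset hpX fun q hq => (hYp q hq).2.1
    · intro u hu v hv huv
      rw [Finset.mem_insert] at hu hv
      rcases hu with rfl | hu
      · rcases hv with rfl | hv
        · exact absurd huv (lt_irrefl _)
        · simp [(hYp v hv).2.2]
      · rcases hv with rfl | hv
        · exact absurd (hlt u hu) (not_lt.2 huv.le)
        · simp [(hYp u hu).1, hc u hu v hv huv]

theorem pair_ramsey (C : Type) [Fintype C] [DecidableEq C] [Nonempty C] :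
    ∃ M : ℕ, ∀ f : ℕ → ℕ → C, ∃ z : Fin 4 → ℕ, StrictMono z ∧ (∀ i, z i < M) ∧
      ∃ c, ∀ i j, i < j → f (z i) (z j) = c := by
  obtain ⟨M, hM⟩ := end_hom C (Fintype.card C * 4)
  refine ⟨M, fun f => ?_⟩
  obtain ⟨Y, hYX, hYc, c, hc⟩ := hM f (Finset.range M) (by simp)
  obtain ⟨c0, _, hc0⟩ := Finset.exists_le_card_fiber_of_mul_le_card_of_maps_to
      (s := Y) (t := (Finset.univ : Finset C)) (f := c) (n := 4)
      (by simp) Finset.univ_nonempty (by rw [Finset.card_univ, hYc])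
  obtain ⟨Z, hZ, hZc⟩ := Finset.exists_subset_card_eq hc0
  have hmem : ∀ i, Z.orderEmbOfFin hZc i ∈ Y ∧ c (Z.orderEmbOfFin hZc i) = c0 := fun i => by
    have := hZ (Z.orderEmbOfFin_mem hZc i)
    simpa using this
  refine ⟨Z.orderEmbOfFin hZc, (Z.orderEmbOfFin hZc).strictMono, ?_, c0, ?_⟩
  · intro i
    simpa using hYX (hmem i).1
  · intro i j hij
    rw [hc _ (hmem i).1 _ (hmem j).1 ((Z.orderEmbOfFin hZc).strictMono hij), (hmem i).2]

theorem prod_ramsey (C : Type) [Fintype C] [DecidableEq C] [Nonempty C] (m : ℕ) :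
    ∃ M : ℕ, ∀ f : (Fin m → ℕ) → (Fin m → ℕ) → C, ∃ z : Fin m → Fin 4 → ℕ,
      (∀ i, StrictMono (z i)) ∧ (∀ i j, z i j < M) ∧
      ∃ c, ∀ α β : Fin m → Fin 4, (∀ i, α i < β i) →
        f (fun i => z i (α i)) (fun i => z i (β i)) = c := by
  induction m with
  | zero =>
    refine ⟨0, fun f => ⟨fun i => i.elim0, fun i => i.elim0, fun i => i.elim0,
      f Fin.elim0 Fin.elim0, fun α β _ => ?_⟩⟩
    congr 1 <;> exact Subsingleton.elim _ _
  | succ m ih =>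
    obtain ⟨M, hM⟩ := ih
    obtain ⟨M0, hM0⟩ := pair_ramsey ((Fin m → Fin M) → (Fin m → Fin M) → C)
    refine ⟨max M M0, fun f => ?_⟩
    obtain ⟨z0, hz0, hz0M, c0, hc0⟩ := hM0 (fun p q x y =>
      f (Fin.cons p (fun i => (x i : ℕ))) (Fin.cons q (fun i => (y i : ℕ))))
    obtain ⟨z, hz, hzM, c, hc⟩ := hM (fun x y => f (Fin.cons (z0 0) x) (Fin.cons (z0 1) y))
    refine ⟨Fin.cons z0 z, ?_, ?_, c, ?_⟩
    · intro i
      refine Fin.cases ?_ (fun i => ?_) i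
      · simpa using hz0
      · simpa using hz i
    · intro i j
      refine Fin.cases ?_ (fun i => ?_) i
      · simp [hz0M]
      · simp [hzM]
    · intro α β hαβ
      have e : ∀ γ : Fin (m + 1) → Fin 4,
          (fun i => (Fin.cons z0 z : Fin (m + 1) → Fin 4 → ℕ) i (γ i)) =
          (Fin.cons (z0 (γ 0)) (fun i => z i (γ i.succ)) : Fin (m + 1) → ℕ) := by
        intro γ
        funext i
        refine Fin.cases ?_ (fun i => ?_) i <;> simp
      rw [e, e, ← hc (fun i => α i.succ) (fun i => β i.succ) (fun i => hαβ _)]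
      have h1 := hc0 _ _ (hαβ 0)
      have h2 := hc0 0 1 (by decide)
      have h3 := congrFun (congrFun (h1.trans h2.symm) (fun i => ⟨z i (α i.succ), hzM _ _⟩))
        (fun i => ⟨z i (β i.succ), hzM _ _⟩)
      simpa using h3

/-- The combinatorial core, in terms of a labelled choice of edges. -/
theorem core_lemma (m : ℕ) (hm : 0 < m) : ∃ n₀ : ℕ, ∀ n ≥ n₀,
    ∀ F : (Fin m → Fin n) → (Fin m ⊕ Fin m → Fin n),
      (∀ t, Function.Injective t → Function.Injective (F t)) →
      (∀ t, Function.Injective t → ∀ i, F t (Sum.inl i) = t i) →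
      ∃ t t', Function.Injective t ∧ Function.Injective t' ∧
        ((Finset.univ.image (F t) ∩ Finset.univ.image (F t')).card = 0 ∨
         (Finset.univ.image (F t) ∩ Finset.univ.image (F t')).card = m) := by
  classical
  obtain ⟨M, hM⟩ := prod_ramsey (Finset (Finset (Fin m) × (Fin m ⊕ Fin m) × (Fin m ⊕ Fin m))) m
  refine ⟨m * M + 1, fun n hn F hinj hinl => ?_⟩
  -- block embedding
  let φ : Fin m → ℕ → Fin n := fun i j => ⟨(i * M + j) % n, Nat.mod_lt _ (by omega)⟩
  have hφ : ∀ i j i' j', j < M → j' < M → φ i j = φ i' j' → i = i' ∧ j = j' := by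
    intro i j i' j' hj hj' h
    have b : ∀ (i : Fin m) (j : ℕ), j < M → i * M + j < n := by
      intro i j hj
      have : (i + 1) * M ≤ m * M := Nat.mul_le_mul_right _ i.2
      have e : ((i : ℕ) + 1) * M = i * M + M := by ring
      omega
    have h1 : (i * M + j) % n = (i' * M + j') % n := congrArg Fin.val h
    rw [Nat.mod_eq_of_lt (b i j hj), Nat.mod_eq_of_lt (b i' j' hj')] at h1
    have hM0 : 0 < M := by omega
    have h2 := congrArg (· / M) h1
    have h3 := congrArg (· % M) h1
    simp only [Nat.mul_add_mod', Nat.mod_eq_of_lt hj, Nat.mod_eq_of_lt hj'] at h3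
    rw [h3] at h1
    have h4 : (i : ℕ) * M = i' * M := by omega
    exact ⟨Fin.ext (Nat.eq_of_mul_eq_mul_right hM0 h4), h3⟩
  obtain ⟨z, hz, hzM, c, hc⟩ := hM (fun x y => Finset.univ.filter (fun p =>
    F (fun i => φ i (x i)) p.2.1 = F (fun i => φ i (if i ∈ p.1 then y i else x i)) p.2.2))
  -- the tuple attached to `α`
  let τ : (Fin m → Fin 4) → (Fin m → Fin n) := fun α i => φ i (z i (α i))
  have hτ : ∀ α, Function.Injective (τ α) := fun α i j h => (hφ _ _ _ _ (hzM _ _) (hzM _ _) h).1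
  have hτ' : ∀ α β i, τ α i = τ β i → α i = β i := fun α β i h =>
    (hz i).injective (hφ _ _ _ _ (hzM _ _) (hzM _ _) h).2
  have hom : ∀ (α β : Fin m → Fin 4), (∀ i, α i < β i) → ∀ P a b,
      (F (τ α) a = F (τ (fun i => if i ∈ P then β i else α i)) b ↔ (P, a, b) ∈ c) := by
    intro α β h P a b
    rw [← hc α β h]
    simp only [Finset.mem_filter, Finset.mem_univ, true_and]
    have : (fun i => φ i (if i ∈ P then z i (β i) else z i (α i))) =
        τ (fun i => if i ∈ P then β i else α i) := by
      funext i
      by_cases hi : i ∈ P <;> simp [τ, hi]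
    rw [this]
  -- indices coincide
  have diag : ∀ P a b, (P, a, b) ∈ c → a = b := by
    intro P a b h
    have h1 := (hom (fun _ => 0) (fun _ => 1) (by intro; decide) P a b).2 h
    have h2 := (hom (fun _ => 0) (fun _ => 2) (by intro; decide) P a b).2 h
    have h3 : F (τ (fun i => if i ∈ P then 1 else 0)) b =
        F (τ (fun i => if i ∈ P then 2 else 0)) b := h1.symm.trans h2
    have h4 := hom (fun i => if i ∈ P then 1 else 0) (fun i => 2)
      (by intro i; by_cases hi : i ∈ P <;> simp [hi]) P b b
    have e : (fun i => if i ∈ P then (2 : Fin 4) else (if i ∈ P then 1 else 0)) =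
        (fun i => if i ∈ P then 2 else 0) := by
      funext i; by_cases hi : i ∈ P <;> simp [hi]
    rw [e] at h4
    have h5 := (hom (fun _ => 0) (fun _ => 1) (by intro; decide) P b b).2 (h4.1 h3)
    exact hinj _ (hτ _) (h1.trans h5.symm)
  let S : Fin m ⊕ Fin m → Finset (Fin m) := fun a => Finset.univ.filter (fun y => ({y}, a, a) ∈ c)
  have hS : ∀ P a, (P, a, a) ∈ c ↔ P ⊆ S a := by
    intro P a
    constructor
    · intro h y hy
      simp only [S, Finset.mem_filter, Finset.mem_univ, true_and]
      have h1 := (hom (fun _ => 0) (fun _ => 2) (by intro; decide) P a a).2 h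
      have h2 := (hom (fun i => if i ∈ ({y} : Finset (Fin m)) then 1 else 0) (fun _ => 2)
        (by intro i; by_cases hi : i = y <;> simp [hi]) P a a).2 h
      have e : (fun i => if i ∈ P then (2 : Fin 4)
          else (if i ∈ ({y} : Finset (Fin m)) then 1 else 0)) =
          (fun i => if i ∈ P then 2 else 0) := by
        funext i
        by_cases hi : i ∈ P
        · simp [hi]
        · have : i ≠ y := fun h => hi (h ▸ hy)
          simp [hi, this]
      rw [e] at h2
      exact (hom (fun _ => 0) (fun _ => 1) (by intro; decide) {y} a a).1 (h1.trans h2.symm)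
    · intro h
      apply (hom (fun _ => 0) (fun _ => 1) (by intro; decide) P a a).1
      induction P using Finset.induction_on with
      | empty => simp
      | insert y P hy ih =>
        have h1 := ih (fun u hu => h (Finset.mem_insert_of_mem hu))
        have hyS : ({y}, a, a) ∈ c := by
          have := h (Finset.mem_insert_self y P)
          simpa [S] using this
        have h2 := (hom (fun i => if i ∈ P then 1 else 0)
          (fun i => if i ∈ P then 2 else 1)
          (by intro i; by_cases hi : i ∈ P <;> simp [hi]) {y} a a).2 hyS
        have e : (fun i => if i ∈ ({y} : Finset (Fin m)) then (if i ∈ P then (2 : Fin 4) else 1)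
            else (if i ∈ P then 1 else 0)) = (fun i => if i ∈ insert y P then 1 else 0) := by
          funext i
          by_cases hi : i = y
          · subst hi; simp [hy]
          · simp [hi]
        rw [e] at h2
        exact h1.trans h2
  let u : Finset (Fin m) → (Fin m → Fin 4) := fun P i => if i ∈ P then 1 else 0
  have hu : ∀ P a b, F (τ (u ∅)) a = F (τ (u P)) b ↔ (a = b ∧ P ⊆ S a) := by
    intro P a b
    have h0 : u ∅ = fun _ => 0 := by funext i; simp [u]
    have h := hom (fun _ => 0) (fun _ => 1) (by intro; decide) P a b
    rw [h0]
    refine h.trans ⟨fun hh => ?_, fun hh => ?_⟩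
    · have := diag _ _ _ hh
      subst this
      exact ⟨rfl, (hS _ _).1 hh⟩
    · obtain ⟨rfl, h2⟩ := hh
      exact (hS _ _).2 h2
  have hSl : ∀ P i, P ⊆ S (Sum.inl i) ↔ i ∉ P := by
    intro P i
    have h := hu P (Sum.inl i) (Sum.inl i)
    rw [hinl _ (hτ _), hinl _ (hτ _)] at h
    simp only [true_and] at h
    rw [← h]
    constructor
    · intro h1 hi
      have := hτ' _ _ _ h1
      simp [u, hi] at this
    · intro hi
      simp [τ, u, hi]
  have hcard : ∀ P, (Finset.univ.image (F (τ (u ∅))) ∩ Finset.univ.image (F (τ (u P)))).card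
      = (m - P.card) + (Finset.univ.filter (fun a : Fin m => P ⊆ S (Sum.inr a))).card := by
    intro P
    have e : Finset.univ.image (F (τ (u ∅))) ∩ Finset.univ.image (F (τ (u P))) =
        (Finset.univ.filter (fun a => P ⊆ S a)).image (F (τ (u ∅))) := by
      ext v
      simp only [Finset.mem_inter, Finset.mem_image, Finset.mem_univ, true_and, Finset.mem_filter]
      constructor
      · rintro ⟨⟨a, rfl⟩, b, hb⟩
        exact ⟨a, ((hu P a b).1 hb.symm).2, rfl⟩
      · rintro ⟨a, ha, rfl⟩
        exact ⟨⟨a, rfl⟩, a, ((hu P a a).2 ⟨rfl, ha⟩).symm⟩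
    rw [e, Finset.card_image_of_injective _ (hinj _ (hτ _))]
    have e2 : (Finset.univ.filter (fun a => P ⊆ S a)) =
        (Pᶜ).disjSum (Finset.univ.filter (fun a : Fin m => P ⊆ S (Sum.inr a))) := by
      ext a
      rcases a with i | a
      · simp [hSl]
      · simp
    rw [e2, Finset.card_disjSum, Finset.card_compl, Fintype.card_fin]
  by_contra hno
  push Not at hno
  have hP := fun P => hno (τ (u ∅)) (τ (u P)) (hτ _) (hτ _)
  simp only [hcard] at hP
  have huniv := (hP Finset.univ).1
  simp only [Finset.card_univ, Fintype.card_fin, Nat.sub_self, zero_add] at huniv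
  obtain ⟨a0, ha0⟩ := Finset.card_pos.1 (Nat.pos_of_ne_zero huniv)
  simp only [Finset.mem_filter, Finset.mem_univ, true_and] at ha0
  have hlt : ((Finset.univ : Finset (Fin m)).erase a0).card < (Finset.univ : Finset (Fin m)).card :=
    Finset.card_erase_lt_of_mem (Finset.mem_univ _)
  obtain ⟨P, _, hne, hPc⟩ := frankl_katona (fun a : Fin m => S (Sum.inr a)) _ Finset.univ
    (Finset.univ.erase a0) rfl hlt
  apply (hP P).2
  have e : Finset.univ.filter (fun a : Fin m => P ⊆ S (Sum.inr a)) =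
      insert a0 ((Finset.univ.erase a0).filter (fun a : Fin m => P ⊆ S (Sum.inr a))) := by
    ext a
    by_cases h : a = a0
    · subst h; simp [(Finset.subset_univ P).trans ha0]
    · simp [h]
  rw [e, Finset.card_insert_of_notMem (by simp), hPc]
  have : P.card ≤ m := by simpa using P.card_le_univ
  omega


/-- If every d-set (d ≥ k/2) has more edges of H than its degree in B_{n,k}(A,B)
(the k-graph of all odd k-sets w.r.t. A), with |A|, |B| ≥ 0.4n, then among the even
edges of H there are two intersecting in 0 or k/2 vertices. -/
theorem two_even_edges (k d : ℕ) (hk : Even k) (hk4 : 4 ≤ k) (hd : k / 2 ≤ d) (hdk : d < k) :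
    ∃ n₀ : ℕ, ∀ n ≥ n₀, ∀ (A : Finset (Fin n)) (H : Finset (Finset (Fin n))),
      (0.4 : ℝ) * n ≤ (A.card : ℝ) →
      (0.4 : ℝ) * n ≤ ((Finset.univ \ A).card : ℝ) →
      (∀ e ∈ H, e.card = k) →
      (∀ S : Finset (Fin n), S.card = d →
        ((Finset.univ.powersetCard k).filter (fun e => S ⊆ e ∧ Odd ((e ∩ A).card))).card
          < (H.filter (fun e => S ⊆ e)).card) →
      ∃ e₁ ∈ H, ∃ e₂ ∈ H, Even ((e₁ ∩ A).card) ∧ Even ((e₂ ∩ A).card) ∧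
        e₁ ≠ e₂ ∧ ((e₁ ∩ e₂).card = 0 ∨ (e₁ ∩ e₂).card = k / 2) := by
  classical
  obtain ⟨m, hm⟩ := hk
  have hk2 : k / 2 = m := by omega
  rw [hk2] at hd ⊢
  obtain ⟨n₀, hn₀⟩ := core_lemma m (by omega)
  refine ⟨max n₀ k, fun n hn A H _ _ hcard hdeg => ?_⟩
  have hnk : k ≤ n := le_trans (le_max_right _ _) hn
  -- every `m`-set lies in an even edge
  have cover : ∀ T : Finset (Fin n), T.card = m →
      ∃ e ∈ H, T ⊆ e ∧ Even ((e ∩ A).card) := by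
    intro T hT
    obtain ⟨S, hTS, _, hSc⟩ := Finset.exists_subsuperset_card_eq (Finset.subset_univ T)
      (n := d) (by omega) (by simp; omega)
    by_contra hcon
    push Not at hcon
    refine absurd (hdeg S hSc) (not_lt.2 (Finset.card_le_card ?_))
    intro e he
    rw [Finset.mem_filter] at he
    rw [Finset.mem_filter, Finset.mem_powersetCard]
    exact ⟨⟨Finset.subset_univ _, hcard e he.1⟩, he.2,
      Nat.not_even_iff_odd.1 (hcon e he.1 (hTS.trans he.2))⟩
  have choice : ∀ t : Fin m → Fin n, ∃ g : Fin m ⊕ Fin m → Fin n, Function.Injective t →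
      Function.Injective g ∧ (∀ i, g (Sum.inl i) = t i) ∧
      Finset.univ.image g ∈ H ∧ Even ((Finset.univ.image g ∩ A).card) := by
    intro t
    by_cases ht : Function.Injective t
    swap
    · exact ⟨Sum.elim t t, fun h => absurd h ht⟩
    have hTc : (Finset.univ.image t).card = m := by
      rw [Finset.card_image_of_injective _ ht]; simp
    obtain ⟨e, heH, hTe, hev⟩ := cover _ hTc
    have hRc : (e \ Finset.univ.image t).card = m := by
      rw [Finset.card_sdiff_of_subset hTe, hTc, hcard e heH]; omega
    let r := (e \ Finset.univ.image t).orderEmbOfFin hRc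
    have hr : ∀ i, r i ∈ e \ Finset.univ.image t := fun i => Finset.orderEmbOfFin_mem _ hRc i
    have hg : Function.Injective (Sum.elim t r) := by
      apply Function.Injective.sumElim ht r.injective
      intro i j hij
      have := hr j
      rw [← hij] at this
      simp at this
    have himg : Finset.univ.image (Sum.elim t r) = e := by
      apply Finset.eq_of_subset_of_card_le
      · intro v hv
        rw [Finset.mem_image] at hv
        obtain ⟨a, _, rfl⟩ := hv
        rcases a with i | i
        · exact hTe (Finset.mem_image_of_mem _ (Finset.mem_univ i))
        · exact (Finset.mem_sdiff.1 (hr i)).1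
      · rw [Finset.card_image_of_injective _ hg, hcard e heH]
        simp; omega
    exact ⟨Sum.elim t r, fun _ => ⟨hg, fun i => rfl, by rw [himg]; exact heH,
      by rw [himg]; exact hev⟩⟩
  choose F hF using choice
  obtain ⟨t, t', ht, ht', hint⟩ := hn₀ n (le_trans (le_max_left _ _) hn) F
    (fun t ht => (hF t ht).1) (fun t ht => (hF t ht).2.1)
  refine ⟨_, (hF t ht).2.2.1, _, (hF t' ht').2.2.1, (hF t ht).2.2.2, (hF t' ht').2.2.2, ?_, hint⟩
  intro heq
  rw [heq, Finset.inter_self, hcard _ (hF t' ht').2.2.1] at hint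
  omega
end

section
/- Let k ≥ 3 be an integer, 1 ≤ d ≤ k−2, and 0 < γ < 1/4, ε > 0. For sufficiently large n the following holds: if H is a k-graph on n vertices such that all but at most ε·C(n,d) of the d-sets S satisfy deg(S) ≥ ((k−d)/k − 1/k^{k−d} + γ)·C(n−d, k−d), then H contains a matching covering all but at most 2ε^{1/k}·n vertices. -/
open Classical in
lemma box_step (N : ℕ) (c : ℝ) (hc : 0 < c) : ∃ c' > (0:ℝ), ∃ n0 : ℕ, ∀ (α β : Type)
    [Fintype α] [Fintype β], n0 ≤ Fintype.card α → ∀ A : Finset (α × β),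
    c * Fintype.card α * Fintype.card β ≤ A.card →
    ∃ w : Fin N → α, Function.Injective w ∧
      c' * Fintype.card β ≤ ((Finset.univ.filter (fun y : β => ∀ j, (w j, y) ∈ A)).card : ℝ) := by
  refine ⟨(c / 2) * (c / 4) ^ N, by positivity, ⌈4 * N / c⌉₊ + 1 + N, ?_⟩
  intro α β _ _ hn A hA
  set n := Fintype.card α with hndef
  set b := Fintype.card β with hbdef
  have hn' : 4 * N / c ≤ n := by
    have := Nat.le_ceil (4 * N / c : ℝ)
    have h2 : ((⌈4 * N / c⌉₊ + 1 : ℕ) : ℝ) ≤ n := by exact_mod_cast (by omega : ⌈4 * N / c⌉₊ + 1 ≤ n)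
    push_cast at h2; linarith
  have hn1 : 4 * (N:ℝ) ≤ c * n := by rw [div_le_iff₀ hc] at hn'; linarith
  have hnpos : (0:ℝ) < n := by
    have : 0 < n := by omega
    exact_mod_cast this
  set nb : β → Finset α := fun y => Finset.univ.filter (fun a => (a, y) ∈ A) with hnb
  have hAsum : (A.card : ℝ) = ∑ y : β, ((nb y).card : ℝ) := by
    have h1 : A.card = ∑ y : β, (nb y).card := by
      rw [Finset.card_eq_sum_card_fiberwise (f := Prod.snd) (t := Finset.univ) (by intro x _; simp)]
      refine Finset.sum_congr rfl fun y _ => ?_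
      refine Finset.card_bij' (fun p _ => p.1) (fun a _ => (a, y)) ?_ ?_ ?_ ?_
      · rintro ⟨a, y'⟩ h; simp at h; simp [hnb]; rw [← h.2]; exact h.1
      · intro a h; simp [hnb] at h; simpa using h
      · rintro ⟨a, y'⟩ h; simp at h; simp [h.2]
      · intro a h; rfl
    rw [h1]; push_cast; rfl
  set rich := Finset.univ.filter (fun y : β => c / 2 * n ≤ (nb y).card) with hrich
  have hrichcard : c / 2 * b ≤ (rich.card : ℝ) := by
    have hle : ∀ y : β, ((nb y).card : ℝ) ≤ c / 2 * n + (if y ∈ rich then (n:ℝ) else 0) := by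
      intro y
      split_ifs with h
      · have : ((nb y).card : ℝ) ≤ n := by exact_mod_cast Finset.card_le_univ _
        have : 0 ≤ c / 2 * n := by positivity
        linarith
      · simp [hrich] at h; linarith
    have h2 := Finset.sum_le_sum (s := Finset.univ) (fun y _ => hle y)
    rw [← hAsum, Finset.sum_add_distrib, Finset.sum_ite_mem] at h2
    simp at h2
    have h3 : c / 2 * b * n ≤ rich.card * n := by
      have : (Fintype.card β : ℝ) = b := rfl
      nlinarith
    exact le_of_mul_le_mul_right h3 hnpos
  -- double count
  by_contra hcon
  push Not at hcon
  have hw : ∀ w : Fin N ↪ α, ((Finset.univ.filter (fun y : β => ∀ j, (w j, y) ∈ A)).card : ℝ)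
      < c / 2 * (c / 4) ^ N * b := fun w => hcon w w.injective
  have hcount : ∑ w : Fin N ↪ α, (Finset.univ.filter (fun y : β => ∀ j, (w j, y) ∈ A)).card
      = ∑ y : β, (Finset.univ.filter (fun w : Fin N ↪ α => ∀ j, (w j, y) ∈ A)).card :=
    Finset.sum_card_bipartiteAbove_eq_sum_card_bipartiteBelow _
  have hlow : ∀ y ∈ rich, (c / 4 * n) ^ N ≤
      ((Finset.univ.filter (fun w : Fin N ↪ α => ∀ j, (w j, y) ∈ A)).card : ℝ) := by
    intro y hy
    simp [hrich] at hy
    have h1 : (nb y).card.descFactorial N ≤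
        (Finset.univ.filter (fun w : Fin N ↪ α => ∀ j, (w j, y) ∈ A)).card := by
      have : (nb y).card.descFactorial N = Fintype.card (Fin N ↪ nb y) := by
        rw [Fintype.card_embedding_eq]; simp
      rw [this, ← Finset.card_univ]
      refine Finset.card_le_card_of_injOn (fun f => f.trans (Function.Embedding.subtype _)) ?_ ?_
      · intro f _
        simp
        intro j
        exact (Finset.mem_filter.1 (f j).2).2
      · intro f _ g _ h
        ext j
        have := DFunLike.congr_fun h j
        simpa using this
    have h2 := Nat.pow_sub_le_descFactorial (nb y).card N
    have h3 : (c / 4 * n) ≤ (((nb y).card + 1 - N : ℕ) : ℝ) := by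
      have : ((nb y).card : ℝ) + 1 - N ≤ (((nb y).card + 1 - N : ℕ) : ℝ) := by
        have : (nb y).card + 1 ≤ ((nb y).card + 1 - N) + N := by omega
        have : (((nb y).card + 1 : ℕ):ℝ) ≤ (((nb y).card + 1 - N) + N : ℕ) := by exact_mod_cast this
        push_cast at this ⊢
        linarith
      linarith
    calc (c / 4 * n) ^ N ≤ (((nb y).card + 1 - N : ℕ) : ℝ) ^ N := by gcongr
      _ ≤ _ := by exact_mod_cast h2.trans h1
  have hR : c / 2 * b * (c / 4 * n) ^ N ≤
      ∑ y : β, ((Finset.univ.filter (fun w : Fin N ↪ α => ∀ j, (w j, y) ∈ A)).card : ℝ) := by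
    calc c / 2 * b * (c / 4 * n) ^ N ≤ rich.card * (c / 4 * n) ^ N := by gcongr
      _ = ∑ y ∈ rich, (c / 4 * n) ^ N := by simp
      _ ≤ ∑ y ∈ rich, ((Finset.univ.filter (fun w : Fin N ↪ α => ∀ j, (w j, y) ∈ A)).card : ℝ) :=
          Finset.sum_le_sum hlow
      _ ≤ _ := Finset.sum_le_sum_of_subset_of_nonneg (Finset.subset_univ _) (by intros; positivity)
  have hne : (Finset.univ : Finset (Fin N ↪ α)).Nonempty := by
    have : N ≤ n := by omega
    have : Nonempty (Fin N ↪ α) := Function.Embedding.nonempty_of_card_le (by simpa using this)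
    exact Finset.univ_nonempty
  have hL := Finset.sum_lt_sum_of_nonempty hne (fun w _ => hw w)
  have hcount' : ∑ w : Fin N ↪ α, ((Finset.univ.filter (fun y : β => ∀ j, (w j, y) ∈ A)).card : ℝ)
      = ∑ y : β, ((Finset.univ.filter (fun w : Fin N ↪ α => ∀ j, (w j, y) ∈ A)).card : ℝ) := by
    exact_mod_cast hcount
  rw [hcount'] at hL
  simp only [Finset.sum_const, nsmul_eq_mul, Finset.card_univ] at hL
  have hcardw : (Fintype.card (Fin N ↪ α) : ℝ) ≤ n ^ N := by
    rw [Fintype.card_embedding_eq]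
    simp only [Fintype.card_fin]
    exact_mod_cast Nat.descFactorial_le_pow _ _
  have : (Fintype.card (Fin N ↪ α) : ℝ) * (c / 2 * (c / 4) ^ N * b) ≤ n ^ N * (c / 2 * (c / 4) ^ N * b) := by
    gcongr
  have e : (n:ℝ) ^ N * (c / 2 * (c / 4) ^ N * b) = c / 2 * b * (c / 4 * n) ^ N := by
    rw [mul_pow]; ring
  linarith

open Classical in
lemma box (N : ℕ) : ∀ (D : ℕ) (c : ℝ), 0 < c → ∃ c' > (0:ℝ), ∃ n0 : ℕ, ∀ (α β : Type)
    [Fintype α] [Fintype β], n0 ≤ Fintype.card α → ∀ A : Finset ((Fin D → α) × β),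
    c * (Fintype.card α : ℝ) ^ D * Fintype.card β ≤ A.card →
    ∃ B : Fin D → Fin N → α, (∀ i, Function.Injective (B i)) ∧
      c' * Fintype.card β ≤ ((Finset.univ.filter
        (fun y : β => ∀ g : Fin D → Fin N, ((fun i => B i (g i)), y) ∈ A)).card : ℝ) := by
  intro D
  induction D with
  | zero =>
    intro c hc
    refine ⟨c, hc, 0, ?_⟩
    intro α β _ _ _ A hA
    refine ⟨fun i => i.elim0, fun i => i.elim0, ?_⟩
    simp only [pow_zero, mul_one] at hA
    refine hA.trans ?_
    norm_cast
    refine Finset.card_le_card_of_injOn Prod.snd ?_ ?_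
    · rintro ⟨x, y⟩ h
      simp only [Finset.coe_filter, Finset.mem_univ, true_and, Set.mem_ofPred_eq]
      intro g
      have e : (fun i : Fin 0 => (Fin.elim0 i : Fin N → α) (g i)) = x := Subsingleton.elim _ _
      rw [e]; exact h
    · rintro ⟨x, y⟩ _ ⟨x', y'⟩ _ h
      exact Prod.ext (Subsingleton.elim _ _) h
  | succ D ih =>
    intro c hc
    obtain ⟨c1, hc1, n1, h1⟩ := box_step N c hc
    obtain ⟨c2, hc2, n2, h2⟩ := ih c1 hc1
    refine ⟨c2, hc2, max n1 n2, ?_⟩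
    intro α β _ _ hn A hA
    set A1 : Finset (α × ((Fin D → α) × β)) :=
      Finset.univ.filter (fun p => (Fin.cons p.1 p.2.1, p.2.2) ∈ A) with hA1
    have hcard : A.card ≤ A1.card := by
      refine Finset.card_le_card_of_injOn (fun p => (p.1 0, (Fin.tail p.1, p.2))) ?_ ?_
      · rintro ⟨x, y⟩ h
        simpa [hA1] using h
      · rintro ⟨x, y⟩ _ ⟨x', y'⟩ _ h
        simp at h
        refine Prod.ext ?_ h.2.2
        simp only
        rw [← Fin.cons_self_tail x, ← Fin.cons_self_tail x', h.1, h.2.1]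
    obtain ⟨w, hw, hwc⟩ := h1 α ((Fin D → α) × β) (le_trans (le_max_left _ _) hn) A1 (by
      refine le_trans (le_of_eq ?_) (hA.trans (by exact_mod_cast hcard))
      simp [Fintype.card_prod]; ring)
    obtain ⟨B, hB, hBc⟩ := h2 α β (le_trans (le_max_right _ _) hn) _ (by
      refine le_trans (le_of_eq ?_) hwc
      simp [Fintype.card_prod]; ring)
    refine ⟨Fin.cons w B, ?_, hBc.trans ?_⟩
    · intro i
      refine Fin.cases ?_ ?_ i
      · simpa using hw
      · intro i; simpa using hB i
    · norm_cast
      refine Finset.card_le_card ?_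
      intro y hy
      simp only [Finset.mem_filter, Finset.mem_univ, true_and] at hy ⊢
      intro g
      have := hy (Fin.tail g) (g 0)
      simp only [hA1, Finset.mem_filter, Finset.mem_univ, true_and] at this
      convert this using 2
      funext i
      refine Fin.cases ?_ ?_ i
      · simp
      · intro i; simp [Fin.tail]

open Classical in
/-- swap identity -/
lemma swap_id (k r s : ℕ) (hk : 3 ≤ k) (L : Finset (Fin r → Fin k))
    (h : ∀ σ : Fin r → Equiv.Perm (Fin k),
      (Finset.univ.filter (fun j : Fin k => (fun i => σ i j) ∈ L)).card = s)
    (i : Fin r) (u v : Fin r → Fin k) (huv : ∀ l, u l ≠ v l) :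
    (if u ∈ L then 1 else 0) + (if v ∈ L then 1 else 0) =
    (if Function.update u i (v i) ∈ L then 1 else 0) +
      (if Function.update v i (u i) ∈ L then 1 else (0:ℕ)) := by
  have : NeZero k := ⟨by omega⟩
  set z : Fin k := ⟨0, by omega⟩ with hz
  set o : Fin k := ⟨1, by omega⟩ with ho
  have hzo : z ≠ o := by simp [hz, ho]
  have hex : ∀ l, ∃ τ : Equiv.Perm (Fin k), τ z = u l ∧ τ o = v l := by
    intro l
    refine ⟨(Equiv.swap z (u l)).trans (Equiv.swap ((Equiv.swap z (u l)) o) (v l)), ?_, ?_⟩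
    · simp only [Equiv.trans_apply, Equiv.swap_apply_left]
      rw [Equiv.swap_apply_of_ne_of_ne]
      · intro hh
        have : Equiv.swap z (u l) z = Equiv.swap z (u l) o := by rw [Equiv.swap_apply_left]; exact hh
        exact hzo ((Equiv.swap z (u l)).injective this)
      · exact huv l
    · simp
  choose σ hσz hσo using hex
  set σ' : Fin r → Equiv.Perm (Fin k) := Function.update σ i ((Equiv.swap z o).trans (σ i)) with hσ'
  have h1 := h σ
  have h2 := h σ'
  rw [Finset.card_filter] at h1 h2
  have hu : (fun i => σ i z) = u := funext hσz
  have hv : (fun i => σ i o) = v := funext hσo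
  have hu' : (fun l => σ' l z) = Function.update u i (v i) := by
    funext l
    by_cases hl : l = i
    · subst hl; simp [hσ', hσo]
    · simp [hσ', hl, hσz]
  have hv' : (fun l => σ' l o) = Function.update v i (u i) := by
    funext l
    by_cases hl : l = i
    · subst hl; simp [hσ', hσz]
    · simp [hσ', hl, hσo]
  have hrest : ∀ j, j ≠ z → j ≠ o → (fun l => σ' l j) = (fun l => σ l j) := by
    intro j hjz hjo
    funext l
    by_cases hl : l = i
    · subst hl; simp [hσ', Equiv.swap_apply_of_ne_of_ne hjz hjo]
    · simp [hσ', hl]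
  rw [← Finset.add_sum_erase _ _ (Finset.mem_univ z),
    ← Finset.add_sum_erase _ _ (Finset.mem_erase.2 ⟨hzo.symm, Finset.mem_univ o⟩)] at h1 h2
  rw [hu, hv] at h1
  rw [hu', hv'] at h2
  have h3 : ∑ x ∈ (Finset.univ.erase z).erase o, (if (fun i => σ' i x) ∈ L then 1 else 0) =
     ∑ x ∈ (Finset.univ.erase z).erase o, (if (fun i => σ i x) ∈ L then 1 else 0) := by
    refine Finset.sum_congr rfl fun j hj => ?_
    simp at hj
    rw [hrest j hj.2 hj.1]
  omega

open Classical in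
lemma full_star_of_all_eq (k r : ℕ) (hk : 3 ≤ k) (hrk : r < k) (hr : 2 ≤ r) (L : Finset (Fin r → Fin k))
    (h : ∀ σ : Fin r → Equiv.Perm (Fin k),
      (Finset.univ.filter (fun j : Fin k => (fun i => σ i j) ∈ L)).card = r) :
    ∃ (i : Fin r) (R : Finset (Fin k)), R.card = r ∧ ∀ p : Fin r → Fin k, p i ∈ R → p ∈ L := by
  have hid : (Finset.univ.filter (fun j : Fin k => (fun _ : Fin r => j) ∈ L)).card = r :=
    h (fun _ => 1)
  -- a drop exists
  have hdrop : ∃ u ∈ L, ∃ i q, Function.update u i q ∉ L := by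
    by_contra hno
    push Not at hno
    have hne : (Finset.univ.filter (fun j : Fin k => (fun _ : Fin r => j) ∈ L)).Nonempty := by
      rw [← Finset.card_pos]; omega
    obtain ⟨j, hj⟩ := hne
    simp at hj
    have hall : ∀ v : Fin r → Fin k, v ∈ L := by
      intro v
      have : ∀ s : Finset (Fin r), (fun l => if l ∈ s then v l else j) ∈ L := by
        intro s
        induction s using Finset.induction_on with
        | empty => simpa using hj
        | insert a s ha ih =>
          have := hno _ ih a (v a)
          convert this using 1
          funext l
          by_cases hl : l = a
          · subst hl; simp
          · simp [hl]
      simpa using this Finset.univ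
    simp [hall] at hid
    omega
  obtain ⟨u, hu, i, q, hq⟩ := hdrop
  have hqu : u i ≠ q := by
    intro hh; apply hq; rw [← hh]; simpa using hu
  have hthird : ∀ a b : Fin k, ∃ c : Fin k, a ≠ c ∧ b ≠ c := by
    intro a b
    have : ({a, b} : Finset (Fin k)).card < Fintype.card (Fin k) := by
      have := Finset.card_le_two (a := a) (b := b)
      simp; omega
    obtain ⟨c, hc⟩ := Finset.exists_mem_notMem_of_card_lt_card (s := {a,b}) (t := Finset.univ) (by simpa using this)
    simp at hc
    exact ⟨c, fun h => hc.1 h.symm, fun h => hc.2 h.symm⟩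
  have key := swap_id k r r hk L h i
  -- all tuples with i-coordinate q not in L
  have hd : ∀ u' : Fin r → Fin k, u' ∈ L → Function.update u' i q ∉ L → u' i ≠ q → ∀ b : Fin r → Fin k, (∀ l, l ≠ i → u' l ≠ b l) →
      Function.update b i (u' i) ∈ L ∧ Function.update b i q ∉ L := by
    intro u' hu hq hqu b hb
    have := key u' (Function.update b i q) (by
      intro l
      by_cases hl : l = i
      · subst hl; simpa using hqu
      · simpa [hl] using hb l hl)
    simp only [Function.update_self, Function.update_idem, if_pos hu, if_neg hq] at this
    split_ifs at this with h1 h2 <;> simp_all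
  have hempty : ∀ b : Fin r → Fin k, b i = q → b ∉ L := by
    intro b hb
    choose c hc1 hc2 using fun l => hthird (u l) (b l)
    obtain ⟨h1, h2⟩ := hd u hu hq hqu c (fun l _ => hc1 l)
    have := (hd _ h1 (by simpa using h2) (by simpa using hqu) b (by
      intro l hl
      simpa [hl] using (hc2 l).symm)).2
    rwa [← hb, Function.update_eq_self] at this
  have htr : ∀ a b : Fin r → Fin k, a ∈ L → (∀ l, l ≠ i → a l ≠ b l) → Function.update b i (a i) ∈ L := by
    intro a b ha hab
    have haq : a i ≠ q := fun hh => hempty a hh ha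
    exact (hd a ha (hempty _ (by simp)) haq b hab).1
  have hfull : ∀ a b : Fin r → Fin k, a ∈ L → a i = b i → b ∈ L := by
    intro a b ha hab
    choose c hc1 hc2 using fun l => hthird (a l) (b l)
    have h1 := htr a c ha (fun l _ => hc1 l)
    have h2 := htr _ b h1 (by intro l hl; simpa [hl] using (hc2 l).symm)
    simpa [hab] using h2
  refine ⟨i, _, hid, ?_⟩
  intro p hp
  exact hfull _ p (Finset.mem_filter.1 hp).2 rfl

open Classical in
lemma all_eq (k r : ℕ) (hk : 3 ≤ k) (hr : 2 ≤ r) (L : Finset (Fin r → Fin k)) (hL : r * k ^ (r-1) ≤ L.card)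
    (h : ∀ σ : Fin r → Equiv.Perm (Fin k),
      (Finset.univ.filter (fun j : Fin k => (fun i => σ i j) ∈ L)).card ≤ r) (σ : Fin r → Equiv.Perm (Fin k)) :
      (Finset.univ.filter (fun j : Fin k => (fun i => σ i j) ∈ L)).card = r := by
  have : NeZero k := ⟨by omega⟩
  set F : (Fin r → Fin k) → ℕ := fun a =>
    (Finset.univ.filter (fun j : Fin k => (fun i => σ i j + a i) ∈ L)).card with hF
  have hle : ∀ a ∈ Finset.univ, F a ≤ r := by
    intro a _
    exact h (fun i => (σ i).trans (Equiv.addRight (a i)))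
  have hsum : ∑ a, F a = k * L.card := by
    have h1 : ∑ a, F a = ∑ j : Fin k, (Finset.univ.filter (fun a : Fin r → Fin k => (fun i => σ i j + a i) ∈ L)).card :=
      Finset.sum_card_bipartiteAbove_eq_sum_card_bipartiteBelow (fun (a : Fin r → Fin k) (j : Fin k) => (fun i => σ i j + a i) ∈ L)
    rw [h1]
    have h2 : ∀ j : Fin k, (Finset.univ.filter (fun a : Fin r → Fin k => (fun i => σ i j + a i) ∈ L)).card = L.card := by
      intro j
      refine Finset.card_bij' (fun a _ => fun i => σ i j + a i) (fun b _ => fun i => b i - σ i j) ?_ ?_ ?_ ?_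
      · intro a ha; simpa using ha
      · intro b hb; simpa using hb
      · intro a _; simp
      · intro b _; simp
    simp [h2]
  have hge : ∑ a : Fin r → Fin k, r ≤ ∑ a, F a := by
    rw [hsum]; simp
    have : k ^ r = k * k ^ (r-1) := by
      rw [← pow_succ']; congr 1; omega
    rw [this]
    nlinarith
  have heq := (Finset.sum_eq_sum_iff_of_le hle).1 (le_antisymm (Finset.sum_le_sum hle) hge)
  have := heq 0 (Finset.mem_univ _)
  simpa [hF] using this

open Classical in
lemma pattern (k r : ℕ) (hk : 3 ≤ k) (hrk : r < k) (hr : 2 ≤ r) (L : Finset (Fin r → Fin k))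
    (hL : r * k ^ (r-1) ≤ L.card) :
    ∃ (I : Type) (_ : Fintype I) (blk : I → Fin r → Fin (k*k)) (lab : I → Fin r → Fin k),
      Fintype.card I ≤ k * k ∧ (∀ j, lab j ∈ L) ∧
      (∀ i, Function.Injective (fun j => (blk j i, lab j i))) ∧
      ∑ i, (Finset.univ.image (fun j => blk j i)).card < Fintype.card I := by
  have hkk : k ≤ k * k := Nat.le_mul_self k
  by_cases hA : ∃ σ : Fin r → Equiv.Perm (Fin k),
      r < (Finset.univ.filter (fun j : Fin k => (fun i => σ i j) ∈ L)).card
  · obtain ⟨σ, hσ⟩ := hA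
    refine ⟨{j // j ∈ Finset.univ.filter (fun j : Fin k => (fun i => σ i j) ∈ L)}, inferInstance,
      fun _ _ => ⟨0, by omega⟩, fun j i => σ i j, ?_, ?_, ?_, ?_⟩
    · have := Finset.card_le_univ (Finset.univ.filter (fun j : Fin k => (fun i => σ i j) ∈ L))
      simp only [Fintype.card_coe]
      simp only [Fintype.card_fin] at this
      omega
    · intro j
      exact (Finset.mem_filter.1 j.2).2
    · intro i j j' hjj
      simp at hjj
      exact hjj
    · rw [Fintype.card_coe]
      refine lt_of_le_of_lt (Finset.sum_le_card_nsmul _ _ 1 ?_) (by simpa using hσ)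
      intro i _
      rw [Finset.card_le_one]
      intro a ha b hb
      simp at ha hb
      rw [← ha.2, ← hb.2]
  · push Not at hA
    obtain ⟨i0, R, hR, hRL⟩ := full_star_of_all_eq k r hk hrk hr L (all_eq k r hk hr L hL hA)
    set e := R.orderEmbOfFin hR with he
    refine ⟨Fin k × Fin r, inferInstance,
      fun j i => if i = i0 then ⟨j.1, by omega⟩ else ⟨j.2, by omega⟩,
      fun j i => if i = i0 then e j.2 else j.1, ?_, ?_, ?_, ?_⟩
    · simp; exact Nat.mul_le_mul_left _ hrk.le
    · intro j
      apply hRL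
      simp [he]
    · intro i ⟨a, b⟩ ⟨a', b'⟩ hjj
      by_cases hi : i = i0
      · simp [hi] at hjj
        ext <;> simp
        · exact hjj.1
        · rw [hjj.2]
      · simp [hi] at hjj
        ext <;> simp
        · rw [hjj.2]
        · exact hjj.1
    · have hb : ∀ i ∈ Finset.univ, (Finset.univ.image (fun j : Fin k × Fin r =>
        (if i = i0 then ⟨j.1, by omega⟩ else ⟨j.2, by omega⟩ : Fin (k*k)))).card ≤
          if i = i0 then k else r := by
        intro i _
        split_ifs with hi
        · have : Finset.univ.image (fun j : Fin k × Fin r => (⟨j.1, by omega⟩ : Fin (k*k))) ⊆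
            Finset.univ.image (fun a : Fin k => (⟨a, by omega⟩ : Fin (k*k))) := by
            intro x hx
            simp only [Finset.mem_image, Finset.mem_univ, true_and] at hx ⊢
            obtain ⟨j, hj⟩ := hx
            exact ⟨j.1, hj⟩
          exact (Finset.card_le_card this).trans (Finset.card_image_le.trans (by simp))
        · have : Finset.univ.image (fun j : Fin k × Fin r => (⟨j.2, by omega⟩ : Fin (k*k))) ⊆
            Finset.univ.image (fun a : Fin r => (⟨a, by omega⟩ : Fin (k*k))) := by
            intro x hx
            simp only [Finset.mem_image, Finset.mem_univ, true_and] at hx ⊢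
            obtain ⟨j, hj⟩ := hx
            exact ⟨j.2, hj⟩
          exact (Finset.card_le_card this).trans (Finset.card_image_le.trans (by simp))
      refine lt_of_le_of_lt (Finset.sum_le_sum hb) ?_
      rw [← Finset.add_sum_erase _ _ (Finset.mem_univ i0), if_pos rfl,
        Finset.sum_congr rfl (g := fun _ => r) (by intro x hx; simp at hx; simp [hx])]
      simp
      obtain ⟨t, rfl⟩ : ∃ t, r = t + 2 := ⟨r - 2, by omega⟩
      have : t + 2 - 1 = t + 1 := by omega
      rw [this]
      nlinarith

open Classical in
lemma augment (n k d r N : ℕ) (hk : 0 < k) (H M P : Finset (Finset (Fin n)))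
    (hH : ∀ e ∈ H, e.card = k) (hMH : M ⊆ H)
    (hMd : ∀ e ∈ M, ∀ f ∈ M, e ≠ f → Disjoint e f) (hMP : M ⊆ P)
    (hPd : ∀ e ∈ P, ∀ f ∈ P, e ≠ f → Disjoint e f)
    (ord : {e // e ∈ P} → Fin k → Fin n) (hoi : ∀ e, Function.Injective (ord e))
    (hom : ∀ e p, ord e p ∈ e.1)
    (B : Fin d → Fin N → Fin n) (hB : ∀ c, Function.Injective (B c))
    (C : Fin r → Fin N → {e // e ∈ P}) (hC : ∀ c, Function.Injective (C c))
    (L : Finset (Fin r → Fin k))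
    (hbox : ∀ (g : Fin d → Fin N) (h : Fin r → Fin N),
      Function.Injective (fun c => B c (g c)) ∧ (∀ c, ∀ e ∈ M, B c (g c) ∉ e) ∧
      Function.Injective (fun i => C i (h i)) ∧ (∀ c i, B c (g c) ∉ (C i (h i)).1) ∧
      (∀ p ∈ L, Finset.univ.image (fun c => B c (g c)) ∪
        Finset.univ.image (fun i => ord (C i (h i)) (p i)) ∈ H))
    (I : Type) [Fintype I] (blk : I → Fin r → Fin N) (lab : I → Fin r → Fin k)
    (hI : Fintype.card I ≤ N) (hlab : ∀ j, lab j ∈ L)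
    (hinj : ∀ i, Function.Injective (fun j => (blk j i, lab j i)))
    (hlt : ∑ i, (Finset.univ.image (fun j => blk j i)).card < Fintype.card I) :
    ∃ M' ⊆ H, (∀ e ∈ M', ∀ f ∈ M', e ≠ f → Disjoint e f) ∧ M.card < M'.card := by
  obtain ⟨ι⟩ : Nonempty (I ↪ Fin N) := Function.Embedding.nonempty_of_card_le (by simpa using hI)
  set E : I → Finset (Fin n) := fun j => Finset.univ.image (fun c => B c (ι j)) ∪
        Finset.univ.image (fun i => ord (C i (blk j i)) (lab j i)) with hE
  have hEH : ∀ j, E j ∈ H := fun j => (hbox (fun _ => ι j) (blk j)).2.2.2.2 _ (hlab j)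
  have hEmem : ∀ j v, v ∈ E j ↔ (∃ c, B c (ι j) = v) ∨ ∃ i, ord (C i (blk j i)) (lab j i) = v := by
    intro j v; simp [hE]
  have hBC : ∀ c a i b, B c a ∉ (C i b).1 := fun c a i b =>
    (hbox (fun _ => a) (fun _ => b)).2.2.2.1 c i
  have hBM : ∀ c a, ∀ e ∈ M, B c a ∉ e := fun c a e he => by
    rcases Nat.eq_zero_or_pos r with h0 | h0
    · subst h0
      exact (hbox (fun _ => a) (fun i => i.elim0)).2.1 c e he
    · exact (hbox (fun _ => a) (fun _ => a)).2.1 c e he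
  have hBB : ∀ c a c' a', a ≠ a' → B c a ≠ B c' a' := by
    intro c a c' a' haa h
    by_cases hcc : c = c'
    · subst hcc; exact haa (hB c h)
    · have := (hbox (fun l => if l = c then a else a') (fun _ => a)).1
      have h2 := @this c c' (by simpa [Ne.symm hcc] using h)
      exact hcc h2
  have hCC : ∀ i a i' a', i ≠ i' → C i a ≠ C i' a' := by
    intro i a i' a' hii h
    rcases Nat.eq_zero_or_pos d with h0 | h0
    · subst h0
      have := (hbox (fun c => c.elim0) (fun l => if l = i then a else a')).2.2.1
      exact hii (@this i i' (by simpa [Ne.symm hii] using h))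
    · have := (hbox (fun _ => a) (fun l => if l = i then a else a')).2.2.1
      exact hii (@this i i' (by simpa [Ne.symm hii] using h))
  have hEd : ∀ j j', j ≠ j' → Disjoint (E j) (E j') := by
    intro j j' hjj
    rw [Finset.disjoint_left]
    intro v hv hv'
    rw [hEmem] at hv hv'
    have hιj : ι j ≠ ι j' := fun h => hjj (ι.injective h)
    rcases hv with ⟨c, rfl⟩ | ⟨i, rfl⟩
    · rcases hv' with ⟨c', h⟩ | ⟨i', h⟩
      · exact hBB _ _ _ _ hιj h.symm
      · exact hBC c (ι j) i' (blk j' i') (h ▸ hom _ _)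
    · rcases hv' with ⟨c', h⟩ | ⟨i', h⟩
      · exact hBC c' (ι j') i (blk j i) (h ▸ hom _ _)
      · by_cases hCe : C i' (blk j' i') = C i (blk j i)
        · have hii : i' = i := by
            by_contra hne; exact hCC _ _ _ _ hne hCe
          subst hii
          have hb := hC _ hCe
          rw [hCe] at h
          have hl := hoi _ h
          exact hjj (hinj i' (by simp [hb, hl]))
        · have := hPd _ (C i' (blk j' i')).2 _ (C i (blk j i)).2 (fun h => hCe (Subtype.ext h))
          exact Finset.disjoint_left.1 this (hom _ (lab j' i')) (by rw [h]; exact hom _ _)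
  have hEne : ∀ j, (E j).Nonempty := fun j => by
    rw [← Finset.card_pos, hH _ (hEH j)]; exact hk
  have hEinj : Function.Injective E := by
    intro j j' h
    by_contra hne
    have := hEd j j' hne
    rw [h, Finset.disjoint_self_iff_empty] at this
    exact (hEne j').ne_empty this
  set used : Finset (Finset (Fin n)) := Finset.univ.biUnion (fun i : Fin r =>
    (Finset.univ.image (fun j => blk j i)).image (fun a => (C i a).1)) with hused
  have husedc : used.card < Fintype.card I := by
    refine lt_of_le_of_lt (Finset.card_biUnion_le.trans (Finset.sum_le_sum fun i _ => ?_)) hlt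
    exact Finset.card_image_le
  have hmemused : ∀ j i, (C i (blk j i)).1 ∈ used := by
    intro j i
    simp only [hused, Finset.mem_biUnion, Finset.mem_image, Finset.mem_univ, true_and]
    exact ⟨i, blk j i, ⟨j, rfl⟩, rfl⟩
  have hEM : ∀ j, ∀ e ∈ M \ used, Disjoint (E j) e := by
    intro j e he
    rw [Finset.mem_sdiff] at he
    rw [Finset.disjoint_left]
    intro v hv hve
    rw [hEmem] at hv
    rcases hv with ⟨c, rfl⟩ | ⟨i, rfl⟩
    · exact hBM _ _ e he.1 hve
    · have hne : (C i (blk j i)).1 ≠ e := fun h => he.2 (h ▸ hmemused j i)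
      exact Finset.disjoint_left.1 (hPd _ (C i (blk j i)).2 _ (hMP he.1) hne) (hom _ _) hve
  refine ⟨(M \ used) ∪ Finset.univ.image E, ?_, ?_, ?_⟩
  · intro e he
    simp only [Finset.mem_union, Finset.mem_image, Finset.mem_univ, true_and] at he
    rcases he with he | ⟨j, rfl⟩
    · exact hMH (Finset.mem_sdiff.1 he).1
    · exact hEH j
  · intro e he f hf hef
    simp only [Finset.mem_union, Finset.mem_image, Finset.mem_univ, true_and] at he hf
    rcases he with he | ⟨j, rfl⟩
    · rcases hf with hf | ⟨j', rfl⟩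
      · exact hMd _ (Finset.mem_sdiff.1 he).1 _ (Finset.mem_sdiff.1 hf).1 hef
      · exact (hEM j' e he).symm
    · rcases hf with hf | ⟨j', rfl⟩
      · exact hEM j f hf
      · exact hEd j j' (fun h => hef (h ▸ rfl))
  · rw [Finset.card_union_of_disjoint, Finset.card_image_of_injective _ hEinj, Finset.card_univ]
    · have := Finset.le_card_sdiff used M
      omega
    · rw [Finset.disjoint_left]
      intro e he he'
      simp only [Finset.mem_image, Finset.mem_univ, true_and] at he'
      obtain ⟨j, rfl⟩ := he'
      have := hEM j _ he
      rw [Finset.disjoint_self_iff_empty] at this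
      exact (hEne j).ne_empty this

/-- maximal disjoint family of k-sets -/
lemma blocks_exist (n k : ℕ) (hk : 0 < k) (M : Finset (Finset (Fin n))) (hM : ∀ e ∈ M, e.card = k)
    (hMd : ∀ e ∈ M, ∀ f ∈ M, e ≠ f → Disjoint e f) :
    ∃ P : Finset (Finset (Fin n)), M ⊆ P ∧ (∀ e ∈ P, e.card = k) ∧
      (∀ e ∈ P, ∀ f ∈ P, e ≠ f → Disjoint e f) ∧
      (Finset.univ \ P.biUnion id).card < k := by
  classical
  set F : Finset (Finset (Finset (Fin n))) := Finset.univ.filter (fun P => M ⊆ P ∧ (∀ e ∈ P, e.card = k) ∧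
      (∀ e ∈ P, ∀ f ∈ P, e ≠ f → Disjoint e f)) with hF
  have hne : F.Nonempty := ⟨M, by simp only [hF, Finset.mem_filter]; exact ⟨Finset.mem_univ _, subset_rfl, hM, hMd⟩⟩
  obtain ⟨P, hP, hmax⟩ := F.exists_max_image Finset.card hne
  simp only [hF, Finset.mem_filter, Finset.mem_univ, true_and] at hP hmax
  refine ⟨P, hP.1, hP.2.1, hP.2.2, ?_⟩
  by_contra hcon
  push Not at hcon
  obtain ⟨S, hS, hSc⟩ := Finset.exists_subset_card_eq hcon
  have hSd : ∀ e ∈ P, Disjoint S e := by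
    intro e he
    rw [Finset.disjoint_left]
    intro v hv hve
    have := hS hv
    simp only [Finset.mem_sdiff, Finset.mem_biUnion, id, Finset.mem_univ, true_and] at this
    exact this ⟨e, he, hve⟩
  have hSP : S ∉ P := by
    intro h
    have := hSd S h
    rw [Finset.disjoint_self_iff_empty] at this
    subst this
    simp at hSc; omega
  have := hmax (insert S P) ⟨hP.1.trans (Finset.subset_insert _ _), by
    intro e he
    rcases Finset.mem_insert.1 he with rfl | he
    · exact hSc
    · exact hP.2.1 e he, by
    intro e he0 f hf hef
    rcases Finset.mem_insert.1 he0 with rfl | he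
    · rcases Finset.mem_insert.1 hf with rfl | hf
      · exact absurd rfl hef
      · exact hSd f hf
    · rcases Finset.mem_insert.1 hf with rfl | hf
      · exact (hSd e (by assumption)).symm
      · exact hP.2.2 e (by assumption) f hf hef⟩
  rw [Finset.card_insert_of_notMem hSP] at this
  omega

open Classical in
lemma count_image (n r : ℕ) (A : Finset (Fin n)) (hA : A.card = r) :
    (Finset.univ.filter (fun t : Fin r → Fin n => Finset.univ.image t = A)).card = r.factorial := by
  have h1 : Fintype.card (Fin r ≃ A) = r.factorial := by
    rw [Fintype.card_equiv ((A.orderIsoOfFin hA).toEquiv)]; simp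
  rw [← h1, ← Finset.card_univ]
  symm
  refine Finset.card_bij (fun f _ => fun i => (f i : Fin n)) ?_ ?_ ?_
  · intro f _
    simp only [Finset.mem_filter, Finset.mem_univ, true_and]
    ext v
    simp only [Finset.mem_image, Finset.mem_univ, true_and]
    constructor
    · rintro ⟨i, rfl⟩; exact (f i).2
    · intro hv
      exact ⟨f.symm ⟨v, hv⟩, by simp⟩
  · intro f _ g _ h
    ext i
    have := congrFun h i
    rw [this]
  · intro t ht
    simp only [Finset.mem_filter, Finset.mem_univ, true_and] at ht
    have hm : ∀ i, t i ∈ A := fun i => ht ▸ Finset.mem_image_of_mem _ (Finset.mem_univ _)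
    have hsurj : Function.Surjective (fun i => (⟨t i, hm i⟩ : A)) := by
      rintro ⟨v, hv⟩
      rw [← ht] at hv
      obtain ⟨i, _, rfl⟩ := Finset.mem_image.1 hv
      exact ⟨i, rfl⟩
    have hbij : Function.Bijective (fun i => (⟨t i, hm i⟩ : A)) :=
      (Fintype.bijective_iff_surjective_and_card _).2 ⟨hsurj, by simp [hA]⟩
    exact ⟨Equiv.ofBijective _ hbij, Finset.mem_univ _, rfl⟩

open Classical in
lemma count_coord (n r z : ℕ) (Q : (Fin (r+1) → Fin n) → Prop) [DecidablePred Q] (i : Fin (r+1))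
    (h : ∀ t' : Fin r → Fin n, (Finset.univ.filter (fun v => Q (Fin.insertNth i v t'))).card ≤ z) :
    (Finset.univ.filter Q).card ≤ z * n ^ r := by
  rw [Finset.card_eq_sum_card_fiberwise (f := fun t => i.removeNth t)
    (t := (Finset.univ : Finset (Fin r → Fin n))) (by intro x _; simp)]
  refine (Finset.sum_le_card_nsmul _ _ z ?_).trans (by simp [mul_comm])
  intro t' _
  refine le_trans ?_ (h t')
  refine Finset.card_le_card_of_injOn (fun t => t i) ?_ ?_
  · intro t ht
    simp only [Finset.coe_filter, Finset.mem_filter, Finset.mem_univ, true_and, Set.mem_ofPred_eq] at ht ⊢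
    rw [← ht.2, Fin.insertNth_self_removeNth]
    exact ht.1
  · intro t ht s hs hts
    simp only [Finset.coe_filter, Finset.mem_filter, Finset.mem_univ, true_and, Set.mem_ofPred_eq] at ht hs hts
    rw [← Fin.insertNth_self_removeNth i t, ← Fin.insertNth_self_removeNth i s, ht.2, hs.2, hts]

open Classical in
lemma link_count (n k d r : ℕ) (hdr : d + r = k) (H : Finset (Finset (Fin n)))
    (hH : ∀ e ∈ H, e.card = k) (S : Finset (Fin n)) (hS : S.card = d) :
    r.factorial * (H.filter (fun e => S ⊆ e)).card ≤
      (Finset.univ.filter (fun t : Fin r → Fin n => S ∪ Finset.univ.image t ∈ H)).card := by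
  rw [mul_comm, ← smul_eq_mul]
  refine (Finset.card_nsmul_le_sum (H.filter (fun e => S ⊆ e)) (fun e =>
    (Finset.univ.filter (fun t : Fin r → Fin n => Finset.univ.image t = e \ S)).card) _ ?_).trans ?_
  · intro e he
    rw [Finset.mem_filter] at he
    rw [count_image]
    rw [Finset.card_sdiff_of_subset he.2, hH e he.1, hS]; omega
  · rw [← Finset.card_biUnion]
    · refine Finset.card_le_card ?_
      intro t ht
      simp only [Finset.mem_biUnion, Finset.mem_filter, Finset.mem_univ, true_and] at ht ⊢
      obtain ⟨e, ⟨he, hSe⟩, h⟩ := ht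
      rw [h, Finset.union_sdiff_of_subset hSe]
      exact he
    · intro e he f hf hef
      rw [Function.onFun, Finset.disjoint_left]
      intro t ht ht'
      simp only [Finset.coe_filter, Finset.mem_filter, Finset.mem_univ, true_and, Set.mem_ofPred_eq] at ht ht' he hf
      apply hef
      rw [← Finset.union_sdiff_of_subset he.2, ← Finset.union_sdiff_of_subset hf.2, ← ht, ← ht']

open Classical in
lemma bad_count (n k d r : ℕ) (hdr : d + (r + 1) = k) (P : Finset (Finset (Fin n)))
    (hPk : ∀ e ∈ P, e.card = k)
    (hPd : ∀ e ∈ P, ∀ f ∈ P, e ≠ f → Disjoint e f)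
    (hU : (Finset.univ \ P.biUnion id).card < k) (x : Fin d → Fin n) :
    (Finset.univ.filter (fun t : Fin (r+1) → Fin n => ∃ i, t i ∉ P.biUnion id ∨
      (∃ c, ∃ e ∈ P, x c ∈ e ∧ t i ∈ e) ∨ (∃ j, j ≠ i ∧ ∃ e ∈ P, t j ∈ e ∧ t i ∈ e))).card
      ≤ 2 * k ^ 3 * n ^ r := by
  set near : Fin n → Finset (Fin n) := fun v => (P.filter (fun e => v ∈ e)).biUnion id with hnear
  have hnc : ∀ v, (near v).card ≤ k := by
    intro v
    have h1 : (P.filter (fun e => v ∈ e)).card ≤ 1 := by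
      rw [Finset.card_le_one]
      intro e he f hf
      rw [Finset.mem_filter] at he hf
      by_contra hne
      exact Finset.disjoint_left.1 (hPd e he.1 f hf.1 hne) he.2 hf.2
    refine (Finset.card_biUnion_le_card_mul _ _ k ?_).trans ?_
    · intro e he
      exact (hPk e (Finset.mem_filter.1 he).1).le
    · nlinarith
  set Q : Fin (r+1) → (Fin (r+1) → Fin n) → Prop := fun i t => t i ∉ P.biUnion id ∨
      (∃ c, ∃ e ∈ P, x c ∈ e ∧ t i ∈ e) ∨ (∃ j, j ≠ i ∧ ∃ e ∈ P, t j ∈ e ∧ t i ∈ e) with hQ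
  have hQi : ∀ i, (Finset.univ.filter (Q i)).card ≤ (2 * k^2) * n ^ r := by
    intro i
    refine count_coord n r _ (Q i) i ?_
    intro t'
    have hsub : (Finset.univ.filter (fun v => Q i (Fin.insertNth i v t'))) ⊆
      (Finset.univ \ P.biUnion id) ∪ (Finset.univ.biUnion (fun c => near (x c)) ∪
        Finset.univ.biUnion (fun j => near (t' j))) := by
      intro v hv
      simp only [hQ, Finset.mem_filter, Finset.mem_univ, true_and, Fin.insertNth_apply_same] at hv
      rw [Finset.mem_union, Finset.mem_union]
      rcases hv with h | ⟨c, e, he, h1, h2⟩ | ⟨j, hj, e, he, h1, h2⟩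
      · left; simpa using h
      · right; left
        simp only [hnear, Finset.mem_biUnion, Finset.mem_filter, Finset.mem_univ, true_and, id]
        exact ⟨c, e, ⟨he, h1⟩, h2⟩
      · right; right
        obtain ⟨j', rfl⟩ := Fin.exists_succAbove_eq hj
        simp only [Fin.insertNth_apply_succAbove] at h1
        simp only [hnear, Finset.mem_biUnion, Finset.mem_filter, Finset.mem_univ, true_and, id]
        exact ⟨j', e, ⟨he, h1⟩, h2⟩
    refine (Finset.card_le_card hsub).trans ?_
    refine (Finset.card_union_le _ _).trans ?_
    have h2 := Finset.card_union_le (Finset.univ.biUnion (fun c => near (x c)))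
        (Finset.univ.biUnion (fun j => near (t' j)))
    have h3 : (Finset.univ.biUnion (fun c => near (x c))).card ≤ d * k := by
      simpa using Finset.card_biUnion_le_card_mul Finset.univ (fun c => near (x c)) k (fun c _ => hnc _)
    have h4 : (Finset.univ.biUnion (fun j => near (t' j))).card ≤ r * k := by
      simpa using Finset.card_biUnion_le_card_mul Finset.univ (fun c => near (t' c)) k (fun c _ => hnc _)
    nlinarith
  have hsub : (Finset.univ.filter (fun t : Fin (r+1) → Fin n => ∃ i, Q i t)) ⊆
      Finset.univ.biUnion (fun i => Finset.univ.filter (Q i)) := by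
    intro t ht
    simpa using ht
  refine (Finset.card_le_card hsub).trans ?_
  refine (Finset.card_biUnion_le_card_mul _ _ _ (fun i _ => hQi i)).trans ?_
  simp only [Finset.card_univ, Fintype.card_fin]
  have : r + 1 ≤ k := by omega
  calc (r+1) * (2 * k^2 * n^r) ≤ k * (2 * k^2 * n^r) := by gcongr
    _ = _ := by ring

open Classical in
noncomputable def Lpat (n k d r : ℕ) (H P : Finset (Finset (Fin n)))
    (ord : {e // e ∈ P} → Fin k → Fin n) (x : Fin d → Fin n) (b : Fin r → {e // e ∈ P}) :
    Finset (Fin r → Fin k) :=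
  Finset.univ.filter (fun p => Finset.univ.image x ∪
        Finset.univ.image (fun i => ord (b i) (p i)) ∈ H)

open Classical in
lemma sum_count (n k d r : ℕ) (hdr : d + (r + 1) = k) (H P : Finset (Finset (Fin n)))
    (hPk : ∀ e ∈ P, e.card = k)
    (hPd : ∀ e ∈ P, ∀ f ∈ P, e ≠ f → Disjoint e f)
    (hU : (Finset.univ \ P.biUnion id).card < k)
    (ord : {e // e ∈ P} → Fin k → Fin n)
    (hos : ∀ e, ∀ v ∈ e.1, ∃ p, ord e p = v) (x : Fin d → Fin n) :
    (Finset.univ.filter (fun t : Fin (r+1) → Fin n => Finset.univ.image x ∪ Finset.univ.image t ∈ H)).card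
      ≤ 2 * k ^ 3 * n ^ r + ((Finset.univ.filter (fun b : Fin (r+1) → {e // e ∈ P} =>
        Function.Injective b ∧ (∀ c i, x c ∉ (b i).1) ∧
          (r+1) * k ^ r ≤ (Lpat n k d (r+1) H P ord x b).card)).card * k ^ (r+1) +
          P.card ^ (r+1) * ((r+1) * k ^ r - 1)) := by
  set T := (Finset.univ.filter (fun t : Fin (r+1) → Fin n => Finset.univ.image x ∪ Finset.univ.image t ∈ H)) with hT
  set Bd := (Finset.univ.filter (fun t : Fin (r+1) → Fin n => ∃ i, t i ∉ P.biUnion id ∨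
      (∃ c, ∃ e ∈ P, x c ∈ e ∧ t i ∈ e) ∨ (∃ j, j ≠ i ∧ ∃ e ∈ P, t j ∈ e ∧ t i ∈ e))) with hBd
  have hBdc : Bd.card ≤ _ := bad_count n k d r hdr P hPk hPd hU x
  set nice := (Finset.univ.filter (fun b : Fin (r+1) → {e // e ∈ P} =>
        Function.Injective b ∧ (∀ c i, x c ∉ (b i).1))) with hnice
  have h1 : (T \ Bd).card ≤ ∑ b ∈ nice, (Lpat n k d (r+1) H P ord x b).card := by
    rw [← Finset.card_sigma]
    refine Finset.card_le_card_of_surjOn (fun q => fun i => ord (q.1 i) (q.2 i)) ?_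
    intro t ht
    simp only [Finset.coe_sdiff, hT, hBd, Set.mem_sdiff, Finset.coe_filter, Finset.mem_univ, true_and, Set.mem_ofPred_eq] at ht
    obtain ⟨ht, hb⟩ := ht
    push Not at hb
    have hcov : ∀ i, ∃ b : {e // e ∈ P}, t i ∈ b.1 := by
      intro i
      have := (hb i).1
      simp only [Finset.mem_biUnion, id] at this
      obtain ⟨e, he, h⟩ := this
      exact ⟨⟨e, he⟩, h⟩
    choose b hbm using hcov
    choose p hp using fun i => hos (b i) (t i) (hbm i)
    refine ⟨⟨b, p⟩, ?_, ?_⟩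
    · simp only [Finset.coe_sigma, Set.mem_sigma_iff, Finset.mem_coe, hnice, Finset.mem_filter, Finset.mem_univ, true_and]
      refine ⟨⟨?_, ?_⟩, ?_⟩
      · intro i j hij
        by_contra hne
        refine (hb i).2.2 j (fun h => hne h.symm) _ (b i).2 ?_ (hbm i)
        rw [hij]; exact hbm j
      · intro c i hx
        exact (hb i).2.1 c _ (b i).2 hx (hbm i)
      · simp only [Lpat, Finset.mem_filter, Finset.mem_univ, true_and, hp]
        exact ht
    · simp only; funext i; exact hp i
  have h2 : T.card ≤ Bd.card + (T \ Bd).card := by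
    have := Finset.le_card_sdiff Bd T
    omega
  refine h2.trans (add_le_add hBdc (h1.trans ?_))
  rw [← Finset.sum_filter_add_sum_filter_not nice (fun b => (r+1) * k ^ r ≤ (Lpat n k d (r+1) H P ord x b).card)]
  refine add_le_add ?_ ?_
  · refine (Finset.sum_le_card_nsmul _ _ (k^(r+1)) ?_).trans ?_
    · intro b _
      refine (Finset.card_le_univ _).trans (by simp)
    · rw [smul_eq_mul]
      refine Nat.mul_le_mul_right _ (Finset.card_le_card ?_)
      intro b hb
      simp only [hnice, Finset.mem_filter, Finset.mem_univ, true_and] at hb ⊢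
      tauto
  · refine (Finset.sum_le_card_nsmul _ _ ((r+1) * k ^ r - 1) ?_).trans ?_
    · intro b hb
      rw [Finset.mem_filter] at hb
      omega
    · rw [smul_eq_mul]
      refine Nat.mul_le_mul_right _ ((Finset.card_le_univ _).trans (by simp))

open Classical in
lemma good_count (n d : ℕ) (X : Finset (Fin n)) (Bad : Finset (Finset (Fin n))) 
    (hBad : ∀ S ∈ Bad, S.card = d) :
    X.card.descFactorial d ≤ (Finset.univ.filter (fun x : Fin d → Fin n => Function.Injective x ∧
      (∀ c, x c ∈ X) ∧ Finset.univ.image x ∉ Bad)).card + d.factorial * Bad.card := by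
  have h1 : X.card.descFactorial d = Fintype.card (Fin d ↪ X) := by
    rw [Fintype.card_embedding_eq]; simp
  have h2 : Fintype.card (Fin d ↪ X) ≤
      (Finset.univ.filter (fun x : Fin d → Fin n => Function.Injective x ∧ (∀ c, x c ∈ X))).card := by
    rw [← Finset.card_univ]
    refine Finset.card_le_card_of_injOn (fun f => fun i => (f i : Fin n)) ?_ ?_
    · intro f _
      simp only [Finset.coe_filter, Finset.mem_univ, true_and, Set.mem_ofPred_eq]
      exact ⟨fun i j h => f.injective (Subtype.ext h), fun c => (f c).2⟩
    · intro f _ g _ h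
      ext i
      have := congrFun h i
      simp only at this
      rw [this]
  rw [h1]
  refine h2.trans ?_
  have h3 : (Bad.biUnion (fun A => Finset.univ.filter (fun t : Fin d → Fin n => Finset.univ.image t = A))).card
     ≤ d.factorial * Bad.card := by
    rw [mul_comm]
    refine Finset.card_biUnion_le_card_mul _ _ _ ?_
    intro A hA
    rw [count_image _ _ _ (hBad A hA)]
  refine le_trans ?_ (Nat.add_le_add_left h3 _)
  refine (Finset.card_le_card ?_).trans (Finset.card_union_le _ _)
  intro x hx
  simp only [Finset.mem_filter, Finset.mem_univ, true_and, Finset.mem_union, Finset.mem_biUnion] at hx ⊢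
  by_cases h : Finset.univ.image x ∈ Bad
  · right; exact ⟨_, h, rfl⟩
  · left; exact ⟨hx.1, hx.2, h⟩

open Classical in
lemma box' (N : ℕ) (D : ℕ) (c : ℝ) (hc : 0 < c) : ∃ c' > (0:ℝ), ∃ n0 : ℕ, ∀ (α β : Type)
    [Fintype α] [Fintype β], n0 ≤ Fintype.card α → ∀ A : Finset ((Fin D → α) × β),
    c * (Fintype.card α : ℝ) ^ D * Fintype.card β ≤ A.card →
    ∃ B : Fin D → Fin N → α, (∀ i, Function.Injective (B i)) ∧ ∃ Y : Finset β,
      c' * Fintype.card β ≤ (Y.card : ℝ) ∧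
        ∀ y ∈ Y, ∀ g : Fin D → Fin N, ((fun i => B i (g i)), y) ∈ A := by
  obtain ⟨c', hc', n0, h⟩ := box N D c hc
  refine ⟨c', hc', n0, ?_⟩
  intro α β _ _ hn A hA
  obtain ⟨B, hB, hY⟩ := h α β hn A hA
  exact ⟨B, hB, _, hY, fun y hy => (Finset.mem_filter.1 hy).2⟩

lemma num1 (n k r q K T : ℕ) (γ θ : ℝ) (hγ0 : 0 < γ) (hγ1 : γ < 1 / 4) (hk : 0 < k) (hrk : r + 1 ≤ k)
    (hθ : θ = ((r:ℝ) + 1) / k - 1 / (k:ℝ) ^ (r+1))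
    (hkn : k ≤ n) (hn : 8 * (k:ℝ) ^ 3 ≤ γ * n) (hq : k * q ≤ n)
    (hT : (θ + γ) * ((n:ℝ) - k) ^ (r+1) ≤ T)
    (hK : T ≤ 2 * k ^ 3 * n ^ r + (K * k ^ (r+1) + q ^ (r+1) * ((r+1) * k ^ r - 1))) :
    γ / 2 * (q:ℝ) ^ (r+1) ≤ K := by
  have hkR : (0:ℝ) < k := by exact_mod_cast hk
  have hk1 : (1:ℝ) ≤ k := by exact_mod_cast hk
  have hknR : (k:ℝ) ≤ n := by exact_mod_cast hkn
  have hnR : (0:ℝ) < n := by linarith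
  have hrkR : (r:ℝ) + 1 ≤ k := by exact_mod_cast hrk
  have hθk : θ * (k:ℝ) ^ (r+1) = ((r:ℝ)+1) * (k:ℝ)^r - 1 := by
    rw [hθ]; field_simp; ring
  have hθ1 : θ ≤ 1 := by
    rw [hθ]
    have h1 : ((r:ℝ)+1)/k ≤ 1 := by rw [div_le_one hkR]; exact hrkR
    have h2 : 0 ≤ 1 / (k:ℝ)^(r+1) := by positivity
    linarith
  have hsub : 1 ≤ (r+1) * k ^ r := Nat.mul_pos (by omega) (pow_pos hk r)
  have hθ0 : 0 ≤ θ := by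
    have h1 : (1:ℝ) ≤ ((r:ℝ)+1) * (k:ℝ)^r := by exact_mod_cast hsub
    have h2 : 0 ≤ θ * (k:ℝ)^(r+1) := by rw [hθk]; linarith
    exact nonneg_of_mul_nonneg_left h2 (by positivity)
  have hKR : (T:ℝ) ≤ 2 * (k:ℝ) ^ 3 * (n:ℝ) ^ r + (K * (k:ℝ) ^ (r+1) + (q:ℝ) ^ (r+1) * (((r:ℝ)+1) * (k:ℝ) ^ r - 1)) := by
    have : (T:ℝ) ≤ ((2 * k ^ 3 * n ^ r + (K * k ^ (r+1) + q ^ (r+1) * ((r+1) * k ^ r - 1)) : ℕ) : ℝ) := by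
      exact_mod_cast hK
    rw [Nat.cast_add, Nat.cast_add, Nat.cast_mul (q ^ (r+1)), Nat.cast_sub hsub] at this
    push_cast at this
    exact this
  have hqn : (k:ℝ)^(r+1) * (q:ℝ)^(r+1) ≤ (n:ℝ)^(r+1) := by
    rw [← mul_pow]
    have : (k:ℝ) * q ≤ n := by exact_mod_cast hq
    gcongr
  have hbern : (n:ℝ)^(r+1) - (k:ℝ)^2 * (n:ℝ)^r ≤ ((n:ℝ) - k)^(r+1) := by
    have h := one_add_mul_le_pow (a := -(k:ℝ)/n) (by
      rw [le_div_iff₀ hnR]; linarith) (r+1)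
    have h2 : (n:ℝ)^(r+1) * (1 + ((r+1:ℕ):ℝ) * (-(k:ℝ)/n)) ≤ (n:ℝ)^(r+1) * (1 + -(k:ℝ)/n)^(r+1) := by
      gcongr
    rw [← mul_pow] at h2
    have h3 : (n:ℝ) * (1 + -(k:ℝ)/n) = n - k := by field_simp; ring
    rw [h3] at h2
    have h4 : (n:ℝ)^(r+1) * (1 + ((r+1:ℕ):ℝ) * (-(k:ℝ)/n)) = (n:ℝ)^(r+1) - ((r:ℝ)+1) * k * (n:ℝ)^r := by
      push_cast; field_simp; ring
    rw [h4] at h2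
    have h5 : ((r:ℝ)+1) * k * (n:ℝ)^r ≤ (k:ℝ)^2 * (n:ℝ)^r := by
      rw [sq]; gcongr
    linarith
  have hA : (θ + γ) * ((n:ℝ)^(r+1) - (k:ℝ)^2 * (n:ℝ)^r) ≤ (θ + γ) * ((n:ℝ) - k)^(r+1) := by
    have : 0 ≤ θ + γ := by linarith
    gcongr
  have hB : θ * ((k:ℝ)^(r+1) * (q:ℝ)^(r+1)) ≤ θ * (n:ℝ)^(r+1) := by gcongr
  have hC : (θ + γ) * ((k:ℝ)^2 * (n:ℝ)^r) ≤ 2 * ((k:ℝ)^3 * (n:ℝ)^r) := by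
    have : (k:ℝ)^2 ≤ (k:ℝ)^3 := pow_le_pow_right₀ hk1 (by norm_num)
    have h0 : θ + γ ≤ 2 := by linarith
    gcongr
  have hD : 8 * (k:ℝ)^3 * (n:ℝ)^r ≤ γ * (n:ℝ)^(r+1) := by
    rw [pow_succ (n:ℝ) r]
    have : 8 * (k:ℝ)^3 * (n:ℝ)^r ≤ γ * n * (n:ℝ)^r := by gcongr
    linarith
  have hE : γ / 2 * (n:ℝ)^(r+1) ≤ K * (k:ℝ)^(r+1) := by
    have : (q:ℝ) ^ (r+1) * (((r:ℝ)+1) * (k:ℝ) ^ r - 1) = θ * ((k:ℝ)^(r+1) * (q:ℝ)^(r+1)) := by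
      rw [← hθk]; ring
    rw [this] at hKR
    nlinarith
  have hF : γ / 2 * (q:ℝ)^(r+1) * (k:ℝ)^(r+1) ≤ K * (k:ℝ)^(r+1) := by
    refine le_trans ?_ hE
    have : γ / 2 * ((k:ℝ)^(r+1) * (q:ℝ)^(r+1)) ≤ γ / 2 * (n:ℝ)^(r+1) := by gcongr
    linarith
  exact le_of_mul_le_mul_right hF (by positivity)

lemma num2 (n k d X G Bd : ℕ) (ξ ε : ℝ) (hξ0 : 0 < ξ) (hξ1 : ξ ≤ 1) (hε : ε = (ξ/2)^k) (hd : 1 ≤ d) (hdk : d < k)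
    (hX : ξ * n ≤ X) (hn : 4 * (d:ℝ) ≤ ξ * n)
    (hG : X.descFactorial d ≤ G + d.factorial * Bd) (hBd : (Bd:ℝ) ≤ ε * (n.choose d : ℝ)) :
    (ξ/2)^d * (n:ℝ)^d ≤ G := by
  have hε0 : 0 ≤ ε := by rw [hε]; positivity
  have h1 : (3/4 * ξ * n)^d ≤ (X.descFactorial d : ℝ) := by
    have h2 := Nat.pow_sub_le_descFactorial X d
    have h3 : (3/4 * ξ * n) ≤ ((X + 1 - d : ℕ) : ℝ) := by
      have : (X:ℝ) + 1 - d ≤ ((X + 1 - d : ℕ) : ℝ) := by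
        have : X + 1 ≤ (X + 1 - d) + d := by omega
        have : ((X + 1 : ℕ):ℝ) ≤ ((X + 1 - d) + d : ℕ) := by exact_mod_cast this
        push_cast at this ⊢
        linarith
      linarith
    calc (3/4 * ξ * n)^d ≤ ((X + 1 - d : ℕ) : ℝ) ^ d := by gcongr
      _ ≤ _ := by exact_mod_cast h2
  have h4 : (d.factorial : ℝ) * (n.choose d : ℝ) ≤ (n:ℝ)^d := by
    have : d.factorial * n.choose d ≤ n ^ d := by
      rw [← Nat.descFactorial_eq_factorial_mul_choose]; exact Nat.descFactorial_le_pow _ _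
    exact_mod_cast this
  have h5 : (d.factorial : ℝ) * Bd ≤ ε * (n:ℝ)^d := by
    calc (d.factorial : ℝ) * Bd ≤ d.factorial * (ε * (n.choose d : ℝ)) := by gcongr
      _ = ε * ((d.factorial : ℝ) * (n.choose d : ℝ)) := by ring
      _ ≤ _ := by gcongr
  have hGR : (X.descFactorial d : ℝ) ≤ G + d.factorial * Bd := by exact_mod_cast hG
  have hε2 : ε ≤ (ξ/2)^d * (1/2) := by
    have : k = d + (k - d) := by omega
    rw [hε, this, pow_add]
    have : (ξ/2)^(k-d) ≤ 1/2 := by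
      calc (ξ/2)^(k-d) ≤ (ξ/2)^1 := pow_le_pow_of_le_one (by positivity) (by linarith) (by omega)
        _ ≤ 1/2 := by rw [pow_one]; linarith
    gcongr
  have h6 : (ξ/2)^d * (3/2) * (n:ℝ)^d ≤ (3/4 * ξ * n)^d := by
    have : (3/4 * ξ * n)^d = (ξ/2)^d * (3/2:ℝ)^d * (n:ℝ)^d := by
      rw [← mul_pow, ← mul_pow]; congr 1; ring
    rw [this]
    have : (3/2:ℝ) ≤ (3/2:ℝ)^d := le_self_pow₀ (by norm_num) (by omega)
    gcongr
  have h7 : ε * (n:ℝ)^d ≤ (ξ/2)^d * (1/2) * (n:ℝ)^d := by gcongr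
  nlinarith

set_option maxHeartbeats 1000000 in
open Classical in
lemma core (k d r : ℕ) (hk : 3 ≤ k) (hd1 : 1 ≤ d) (hdr : d + (r + 1) = k) (hr : 1 ≤ r)
    (γ ε ξ θ : ℝ) (hγ0 : 0 < γ) (hγ : γ < 1 / 4) (hξ0 : 0 < ξ) (hε : ε = (ξ/2)^k)
    (hθ : θ = ((r:ℝ) + 1) / k - 1 / (k:ℝ) ^ (r+1)) :
    ∃ n₀ : ℕ, ∀ n ≥ n₀, ∀ H : Finset (Finset (Fin n)),
      (∀ e ∈ H, e.card = k) → ∀ Bad : Finset (Finset (Fin n)), (∀ S ∈ Bad, S.card = d) →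
      (∀ S, S.card = d → S ∉ Bad →
          (θ + γ) * (Nat.choose (n - d) (r+1) : ℝ) ≤ ((H.filter (fun e => S ⊆ e)).card : ℝ)) →
      (Bad.card : ℝ) ≤ ε * (Nat.choose n d : ℝ) →
      ∃ M ⊆ H, (∀ e ∈ M, ∀ f ∈ M, e ≠ f → Disjoint e f) ∧
        (n : ℝ) - k * M.card ≤ ξ * n := by
  set c0 : ℝ := (ξ/2)^d * (γ/2) / 2^(k^(r+1)) with hc0
  have hc0pos : 0 < c0 := by positivity
  obtain ⟨c1, hc1, n1, hbox1⟩ := box' (k*k) d c0 hc0pos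
  obtain ⟨c2, hc2, n2, hbox2⟩ := box' (k*k) (r+1) c1 hc1
  refine ⟨n1 + (k * n2 + k) + ⌈8 * (k:ℝ)^3 / γ⌉₊ + ⌈4 * (d:ℝ) / ξ⌉₊ + 1, ?_⟩
  intro n hn H hH Bad hBad hdeg hBadc
  have hkpos : 0 < k := by omega
  have hkR : (0:ℝ) < k := by exact_mod_cast hkpos
  have hn3 : 8 * (k:ℝ)^3 ≤ γ * n := by
    have h1 := Nat.le_ceil (8 * (k:ℝ)^3 / γ)
    have h2 : ((⌈8 * (k:ℝ)^3 / γ⌉₊ : ℕ):ℝ) ≤ n := by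
      have : ⌈8 * (k:ℝ)^3 / γ⌉₊ ≤ n := by omega
      exact_mod_cast this
    have := (div_le_iff₀ hγ0).1 (h1.trans h2)
    linarith
  have hn4 : 4 * (d:ℝ) ≤ ξ * n := by
    have h1 := Nat.le_ceil (4 * (d:ℝ) / ξ)
    have h2 : ((⌈4 * (d:ℝ) / ξ⌉₊ : ℕ):ℝ) ≤ n := by
      have : ⌈4 * (d:ℝ) / ξ⌉₊ ≤ n := by omega
      exact_mod_cast this
    have := (div_le_iff₀ hξ0).1 (h1.trans h2)
    linarith
  have hn1 : n1 ≤ n := by omega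
  have hn2 : k * n2 + k ≤ n := by omega
  have hnpos : (0:ℝ) < n := by
    have : 0 < n := by omega
    exact_mod_cast this
  have hkn : k ≤ n := by omega
  clear hn
  -- a maximum matching
  set F : Finset (Finset (Finset (Fin n))) := Finset.univ.filter (fun M => M ⊆ H ∧
      (∀ e ∈ M, ∀ f ∈ M, e ≠ f → Disjoint e f)) with hF
  have hne : F.Nonempty := ⟨∅, by simp [hF]⟩
  obtain ⟨M, hM, hmax⟩ := F.exists_max_image Finset.card hne
  simp only [hF, Finset.mem_filter, Finset.mem_univ, true_and] at hM hmax
  obtain ⟨hMH, hMd⟩ := hM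
  refine ⟨M, hMH, hMd, ?_⟩
  by_contra hcon
  push Not at hcon
  have hξ1 : ξ ≤ 1 := by
    have h1 : (0:ℝ) ≤ k * M.card := by positivity
    have : ξ * n ≤ 1 * n := by linarith
    exact le_of_mul_le_mul_right this hnpos
  have hMk : ∀ e ∈ M, e.card = k := fun e he => hH e (hMH he)
  obtain ⟨P, hMP, hPk, hPd, hU⟩ := blocks_exist n k hkpos M hMk hMd
  have hPcard : (P.biUnion id).card = k * P.card := by
    rw [Finset.card_biUnion (t := id) (fun e he f hf hef => hPd e he f hf hef),
      show ∑ u ∈ P, (id u).card = ∑ u ∈ P, u.card from rfl,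
      Finset.sum_congr rfl (fun e he => hPk e he)]
    simp [mul_comm]
  have hMcard : (M.biUnion id).card = k * M.card := by
    rw [Finset.card_biUnion (t := id) (fun e he f hf hef => hMd e he f hf hef),
      show ∑ u ∈ M, (id u).card = ∑ u ∈ M, u.card from rfl,
      Finset.sum_congr rfl (fun e he => hMk e he)]
    simp [mul_comm]
  have hq : k * P.card ≤ n := by
    rw [← hPcard]; simpa using Finset.card_le_univ (P.biUnion id)
  have hq2 : n2 ≤ P.card := by
    rw [Finset.card_sdiff_of_subset (Finset.subset_univ _), hPcard] at hU
    simp only [Finset.card_univ, Fintype.card_fin] at hU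
    have : k * n2 ≤ k * P.card := by omega
    exact Nat.le_of_mul_le_mul_left this hkpos
  set X : Finset (Fin n) := Finset.univ \ M.biUnion id with hX
  have hXc : ξ * n ≤ X.card := by
    have h1 := Finset.card_sdiff_add_card_eq_card (Finset.subset_univ (M.biUnion id))
    rw [← hX, hMcard] at h1
    simp only [Finset.card_univ, Fintype.card_fin] at h1
    have : (X.card : ℝ) + k * M.card = n := by exact_mod_cast h1
    linarith
  have hXM : ∀ v ∈ X, ∀ e ∈ M, v ∉ e := by
    intro v hv e he hve
    simp only [hX, Finset.mem_sdiff, Finset.mem_univ, true_and, Finset.mem_biUnion, id] at hv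
    exact hv ⟨e, he, hve⟩
  set ord : {e // e ∈ P} → Fin k → Fin n := fun e => e.1.orderEmbOfFin (hPk e.1 e.2) with hord
  have hoi : ∀ e, Function.Injective (ord e) := fun e => (e.1.orderEmbOfFin (hPk e.1 e.2)).injective
  have hom : ∀ e p, ord e p ∈ e.1 := fun e p => Finset.orderEmbOfFin_mem _ _ _
  have hos : ∀ e, ∀ v ∈ e.1, ∃ p, ord e p = v := by
    intro e v hv
    have := Finset.range_orderEmbOfFin e.1 (hPk e.1 e.2)
    have hv' : v ∈ Set.range (e.1.orderEmbOfFin (hPk e.1 e.2)) := by rw [this]; exact hv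
    exact hv'
  -- good tuples
  set G := (Finset.univ.filter (fun x : Fin d → Fin n => Function.Injective x ∧
      (∀ c, x c ∈ X) ∧ Finset.univ.image x ∉ Bad)) with hG
  have hGc : (ξ/2)^d * (n:ℝ)^d ≤ G.card :=
    num2 n k d X.card G.card Bad.card ξ ε hξ0 hξ1 hε hd1 (by omega) hXc hn4
      (good_count n d X Bad hBad) hBadc
  set KK : (Fin d → Fin n) → Finset (Fin (r+1) → {e // e ∈ P}) := fun x =>
    Finset.univ.filter (fun b : Fin (r+1) → {e // e ∈ P} =>
        Function.Injective b ∧ (∀ c i, x c ∉ (b i).1) ∧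
          (r+1) * k ^ r ≤ (Lpat n k d (r+1) H P ord x b).card) with hKK
  have hKc : ∀ x ∈ G, γ / 2 * (P.card:ℝ)^(r+1) ≤ (KK x).card := by
    intro x hx
    simp only [hG, Finset.mem_filter, Finset.mem_univ, true_and] at hx
    have hS : (Finset.univ.image x).card = d := by
      rw [Finset.card_image_of_injective _ hx.1]; simp
    refine num1 n k r P.card (KK x).card _ γ θ hγ0 hγ hkpos (by omega) hθ hkn hn3 hq ?_
      (sum_count n k d r hdr H P hPk hPd hU ord hos x)
    have h1 := link_count n k d (r+1) hdr H hH _ hS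
    have h2 := hdeg _ hS hx.2.2
    have h3 := Nat.pow_sub_le_descFactorial (n - d) (r+1)
    rw [Nat.descFactorial_eq_factorial_mul_choose] at h3
    have h4 : ((n:ℝ) - k)^(r+1) ≤ ((r+1).factorial : ℝ) * ((n-d).choose (r+1) : ℝ) := by
      have e1 : (n:ℝ) - k ≤ ((n - d + 1 - (r+1) : ℕ) : ℝ) := by
        have : n ≤ (n - d + 1 - (r+1)) + k := by omega
        have : (n:ℝ) ≤ ((n - d + 1 - (r+1) : ℕ) : ℝ) + k := by exact_mod_cast this
        linarith
      have e0 : (0:ℝ) ≤ (n:ℝ) - k := by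
        have : (k:ℝ) ≤ n := by exact_mod_cast hkn
        linarith
      calc ((n:ℝ) - k)^(r+1) ≤ ((n - d + 1 - (r+1) : ℕ) : ℝ)^(r+1) := by gcongr
        _ ≤ _ := by exact_mod_cast h3
    have hθγ : 0 ≤ θ + γ := by
      have : 0 ≤ θ := by
        rw [hθ, sub_nonneg, div_le_div_iff₀ (by positivity) hkR]
        have hk1 : (1:ℝ) ≤ k := by exact_mod_cast hkpos
        have h5 : (1:ℝ) ≤ (k:ℝ)^r := one_le_pow₀ hk1
        have : (1:ℝ) ≤ (r:ℝ)+1 := by have : (0:ℝ) ≤ r := by positivity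
                                     linarith
        calc 1 * (k:ℝ) ≤ (((r:ℝ)+1) * (k:ℝ)^r) * k := by
              gcongr
              nlinarith
          _ = _ := by ring
      linarith
    calc (θ + γ) * ((n:ℝ) - k)^(r+1) ≤ (θ + γ) * (((r+1).factorial : ℝ) * ((n-d).choose (r+1) : ℝ)) := by
          gcongr
      _ = ((r+1).factorial : ℝ) * ((θ + γ) * ((n-d).choose (r+1) : ℝ)) := by ring
      _ ≤ ((r+1).factorial : ℝ) * ((H.filter (fun e => Finset.univ.image x ⊆ e)).card : ℝ) := by gcongr
      _ ≤ _ := by exact_mod_cast h1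
  -- pairs
  set W : Finset ((Fin d → Fin n) × (Fin (r+1) → {e // e ∈ P})) :=
    Finset.univ.filter (fun p => p.1 ∈ G ∧ p.2 ∈ KK p.1) with hW
  have hWc : (ξ/2)^d * (γ/2) * (n:ℝ)^d * (P.card:ℝ)^(r+1) ≤ W.card := by
    have h1 : ∑ x ∈ G, (KK x).card ≤ W.card := by
      rw [← Finset.card_sigma]
      refine Finset.card_le_card_of_injOn (fun p => (p.1, p.2)) ?_ ?_
      · rintro ⟨x, b⟩ h
        simpa [hW] using h
      · rintro ⟨x, b⟩ _ ⟨x', b'⟩ _ h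
        simpa using h
    have h2 : (G.card : ℝ) * (γ / 2 * (P.card:ℝ)^(r+1)) ≤ ∑ x ∈ G, ((KK x).card : ℝ) := by
      have := Finset.card_nsmul_le_sum G (fun x => ((KK x).card : ℝ)) _ hKc
      simpa using this
    have h3 : (∑ x ∈ G, ((KK x).card : ℝ)) ≤ W.card := by exact_mod_cast h1
    calc _ = ((ξ/2)^d * (n:ℝ)^d) * (γ / 2 * (P.card:ℝ)^(r+1)) := by ring
      _ ≤ (G.card : ℝ) * (γ / 2 * (P.card:ℝ)^(r+1)) := by gcongr
      _ ≤ _ := h2.trans h3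
  have hpig : ∃ L : Finset (Fin (r+1) → Fin k), c0 * (n:ℝ)^d * (P.card:ℝ)^(r+1) ≤
      (W.filter (fun p => Lpat n k d (r+1) H P ord p.1 p.2 = L)).card := by
    by_contra hno
    push Not at hno
    have h1 := Finset.card_eq_sum_card_fiberwise (s := W)
      (f := fun p => Lpat n k d (r+1) H P ord p.1 p.2) (t := Finset.univ) (by intro x _; simp)
    have h2 : (W.card : ℝ) < ∑ L : Finset (Fin (r+1) → Fin k), c0 * (n:ℝ)^d * (P.card:ℝ)^(r+1) := by
      rw [h1]; push_cast
      exact Finset.sum_lt_sum_of_nonempty Finset.univ_nonempty (fun L _ => hno L)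
    have h3 : (∑ L : Finset (Fin (r+1) → Fin k), c0 * (n:ℝ)^d * (P.card:ℝ)^(r+1)) =
        (ξ/2)^d * (γ/2) * (n:ℝ)^d * (P.card:ℝ)^(r+1) := by
      simp only [Finset.sum_const, Finset.card_univ, Fintype.card_finset, Fintype.card_pi,
        Fintype.card_fin, Finset.prod_const, nsmul_eq_mul, hc0]
      push_cast
      field_simp
    linarith
  obtain ⟨L, hL⟩ := hpig
  set A := W.filter (fun p => Lpat n k d (r+1) H P ord p.1 p.2 = L) with hA
  obtain ⟨B, hB, Y, hYc, hY⟩ := hbox1 (Fin n) (Fin (r+1) → {e // e ∈ P}) (by simpa using hn1) A (by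
    refine le_trans (le_of_eq ?_) hL
    simp)
  obtain ⟨C, hC, Z, hZc, hZ⟩ := hbox2 {e // e ∈ P} Unit (by simpa using hq2)
    (Y.map ⟨fun y => (y, ()), fun y y' h => congrArg Prod.fst h⟩) (by
    rw [Finset.card_map]
    refine le_trans (le_of_eq ?_) hYc
    simp)
  have hZne : Z.Nonempty := by
    rw [← Finset.card_pos]
    have : (0:ℝ) < Z.card := lt_of_lt_of_le (by simpa using hc2) hZc
    exact_mod_cast this
  obtain ⟨z0, hz0⟩ := hZne
  have hCne : ∀ h : Fin (r+1) → Fin (k*k), (fun i => C i (h i)) ∈ Y := by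
    intro h
    obtain ⟨y, hy, hyy⟩ := Finset.mem_map.1 (hZ z0 hz0 h)
    have : y = fun i => C i (h i) := congrArg Prod.fst hyy
    rw [← this]; exact hy
  have hmem : ∀ (g : Fin d → Fin (k*k)) (h : Fin (r+1) → Fin (k*k)),
      ((fun i => B i (g i)), (fun i => C i (h i))) ∈ A := fun g h =>
    hY _ (hCne h) g
  have hfull : ∀ (g : Fin d → Fin (k*k)) (h : Fin (r+1) → Fin (k*k)),
      (fun i => B i (g i)) ∈ G ∧ (fun i => C i (h i)) ∈ KK (fun i => B i (g i)) ∧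
      Lpat n k d (r+1) H P ord (fun i => B i (g i)) (fun i => C i (h i)) = L := by
    intro g h
    have h1 := Finset.mem_filter.1 (hmem g h)
    have h2 := (Finset.mem_filter.1 h1.1).2
    exact ⟨h2.1, h2.2, h1.2⟩
  have hLc : (r+1) * k ^ (r+1-1) ≤ L.card := by
    have z : Fin (k*k) := ⟨0, Nat.mul_pos hkpos hkpos⟩
    obtain ⟨_, h2, h3⟩ := hfull (fun _ => z) (fun _ => z)
    rw [← h3]
    exact (Finset.mem_filter.1 h2).2.2.2
  obtain ⟨I, hIf, blk, lab, hI1, hI2, hI3, hI4⟩ := pattern k (r+1) hk (by omega) (by omega) L hLc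
  obtain ⟨M', hM'H, hM'd, hlt⟩ := augment n k d (r+1) (k*k) hkpos H M P hH hMH hMd hMP hPd ord hoi hom
    B hB C hC L (by
      intro g h
      obtain ⟨h1, h2, h3⟩ := hfull g h
      have h1' := (Finset.mem_filter.1 h1).2
      have h2' := (Finset.mem_filter.1 h2).2
      refine ⟨h1'.1, fun c e he => hXM _ (h1'.2.1 c) e he, h2'.1, h2'.2.1, ?_⟩
      intro p hp
      rw [← h3] at hp
      exact (Finset.mem_filter.1 hp).2) I blk lab hI1 hI2 hI3 hI4
  exact absurd (hmax M' ⟨hM'H, hM'd⟩) (by omega)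

/-- Markström–Ruciński-type theorem allowing a small proportion of d-sets with small
degree: the k-graph contains a matching covering all but at most 2ε^{1/k}n vertices. -/
theorem almost_perfect_matching (k d : ℕ) (hk : 3 ≤ k) (hd1 : 1 ≤ d) (hd2 : d ≤ k - 2)
    (γ ε : ℝ) (hγ0 : 0 < γ) (hγ : γ < 1 / 4) (hε : 0 < ε) :
    ∃ n₀ : ℕ, ∀ n ≥ n₀, ∀ H : Finset (Finset (Fin n)),
      (∀ e ∈ H, e.card = k) →
      (((Finset.univ.powersetCard d).filter (fun S =>
          ((H.filter (fun e => S ⊆ e)).card : ℝ) <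
            (((k : ℝ) - d) / k - 1 / (k : ℝ) ^ (k - d) + γ) *
              (Nat.choose (n - d) (k - d) : ℝ))).card : ℝ)
        ≤ ε * (Nat.choose n d : ℝ) →
      ∃ M ⊆ H, (∀ e ∈ M, ∀ f ∈ M, e ≠ f → Disjoint e f) ∧
        (n : ℝ) - k * M.card ≤ 2 * ε ^ ((1 : ℝ) / k) * n := by
  obtain ⟨r, hr⟩ : ∃ r, k - d = r + 1 := ⟨k - d - 1, by omega⟩
  have hε2 : ε = ((2 * ε ^ ((1 : ℝ) / k)) / 2) ^ k := by
    rw [mul_div_cancel_left₀ _ (by norm_num : (2:ℝ) ≠ 0), one_div,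
      Real.rpow_inv_natCast_pow hε.le (by omega)]
  have hkd : (k:ℝ) - d = r + 1 := by
    have : k = d + (r + 1) := by omega
    rw [this]; push_cast; ring
  obtain ⟨n₀, h⟩ := core k d r hk hd1 (by omega) (by omega) γ ε (2 * ε ^ ((1 : ℝ) / k))
    (((r:ℝ) + 1) / k - 1 / (k:ℝ) ^ (r+1)) hγ0 hγ (by positivity) hε2 rfl
  refine ⟨n₀, fun n hn H hH hb => ?_⟩
  rw [hr, hkd] at hb
  refine h n hn H hH _ ?_ ?_ hb
  · intro S hS
    exact (Finset.mem_powersetCard.1 (Finset.mem_filter.1 hS).1).2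
  · intro S hS hSB
    by_contra hlt
    push Not at hlt
    apply hSB
    rw [Finset.mem_filter, Finset.mem_powersetCard]
    refine ⟨⟨Finset.subset_univ _, hS⟩, ?_⟩
    convert hlt
end
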